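/- arXiv:math/0404549 — 9 statements merged into one kernel-verified Lean document; each statement's English description precedes it below -/
import Mathlib

section
/- Sp(k,ℓ) is a subgroup of Sp(ℓ), and the map ϖ is well defined and surjective: for every A ∈ Sp(k,ℓ) the upper-left k×k block A₁ is invertible and the submatrix A₂ (formed by rows and columns with indices in {k+1,…,ℓ} ∪ {ℓ+k+1,…,2ℓ}) lies in Sp(ℓ−k); moreover ϖ : Sp(k,ℓ) → GL(k,ℝ) × Sp(ℓ−k) is a surjective group homomorphism. -/
open Matrix

/-- Half index type: `Fin k ⊕ Fin m` with `m = ℓ - k`. -/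
abbrev HalfIdx (k m : ℕ) := Fin k ⊕ Fin m

/-- Full index type for `2ℓ × 2ℓ` matrices, in block form `(k, m, k, m)`. -/
abbrev FullIdx (k m : ℕ) := HalfIdx k m ⊕ HalfIdx k m

/-- The standard symplectic matrix `J = [[0, I], [-I, 0]]`. -/
def Jmat (k m : ℕ) : Matrix (FullIdx k m) (FullIdx k m) ℝ :=
  Matrix.fromBlocks 0 1 (-1) 0

/-- The symplectic group `Sp(ℓ)`: matrices with `Mᵀ J M = J`. -/
def SpBig (k m : ℕ) : Set (Matrix (FullIdx k m) (FullIdx k m) ℝ) :=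
  {M | Mᵀ * Jmat k m * M = Jmat k m}

def Jsmall (m : ℕ) : Matrix (Fin m ⊕ Fin m) (Fin m ⊕ Fin m) ℝ :=
  Matrix.fromBlocks 0 1 (-1) 0

/-- The symplectic group `Sp(ℓ-k)`. -/
def SpSmall (m : ℕ) : Set (Matrix (Fin m ⊕ Fin m) (Fin m ⊕ Fin m) ℝ) :=
  {S | Sᵀ * Jsmall m * S = Jsmall m}

/-- Embedding of block indices `1..4` of sizes `k, m, k, m`. -/
def r1 (k m : ℕ) : Fin k → FullIdx k m := fun i => Sum.inl (Sum.inl i)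
def r2 (k m : ℕ) : Fin m → FullIdx k m := fun i => Sum.inl (Sum.inr i)
def r3 (k m : ℕ) : Fin k → FullIdx k m := fun i => Sum.inr (Sum.inl i)
def r4 (k m : ℕ) : Fin m → FullIdx k m := fun i => Sum.inr (Sum.inr i)

/-- Embedding of the indices `{k+1,…,ℓ} ∪ {ℓ+k+1,…,2ℓ}`. -/
def embSmall (k m : ℕ) : Fin m ⊕ Fin m → FullIdx k m :=
  Sum.elim (fun i => Sum.inl (Sum.inr i)) (fun i => Sum.inr (Sum.inr i))

/-- The upper-left `k × k` block `A₁`. -/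
def blk1 (k m : ℕ) (M : Matrix (FullIdx k m) (FullIdx k m) ℝ) : Matrix (Fin k) (Fin k) ℝ :=
  M.submatrix (r1 k m) (r1 k m)

/-- The `2(ℓ-k) × 2(ℓ-k)` submatrix `A₂`. -/
def blk2 (k m : ℕ) (M : Matrix (FullIdx k m) (FullIdx k m) ℝ) :
    Matrix (Fin m ⊕ Fin m) (Fin m ⊕ Fin m) ℝ :=
  M.submatrix (embSmall k m) (embSmall k m)

/-- `Sp(k,ℓ)`: symplectic matrices with `a_{ij} = 0` for `1 ≤ j ≤ k` and `i > k`. -/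
def SpKL (k m : ℕ) : Set (Matrix (FullIdx k m) (FullIdx k m) ℝ) :=
  {M | M ∈ SpBig k m ∧
    ∀ (i : FullIdx k m) (j : Fin k), (∀ i' : Fin k, i ≠ r1 k m i') → M i (r1 k m j) = 0}

/-- The kernel `T` of `ϖ : Sp(k,ℓ) → GL(k,ℝ) × Sp(ℓ-k)`. -/
def kerVarpi (k m : ℕ) : Set (Matrix (FullIdx k m) (FullIdx k m) ℝ) :=
  {M | M ∈ SpKL k m ∧ blk1 k m M = 1 ∧ blk2 k m M = 1}

/-- `Sp₊(k,ℓ)`: elements of `Sp(k,ℓ)` with `det A₁ > 0`. -/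
def SpPlus (k m : ℕ) : Set (Matrix (FullIdx k m) (FullIdx k m) ℝ) :=
  {M | M ∈ SpKL k m ∧ 0 < (blk1 k m M).det}

/-- The kernel of `γ : Sp₊(k,ℓ) → Sp(ℓ-k)`, the second component of `ϖ`. -/
def kerGamma (k m : ℕ) : Set (Matrix (FullIdx k m) (FullIdx k m) ℝ) :=
  {M | M ∈ SpPlus k m ∧ blk2 k m M = 1}

lemma transpose_mul_J_mul_apply {n : Type*} [Fintype n] [DecidableEq n]
    (M : Matrix (n ⊕ n) (n ⊕ n) ℝ) (i j : n ⊕ n) :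
    (Mᵀ * (fromBlocks 0 1 (-1) 0 : Matrix (n ⊕ n) (n ⊕ n) ℝ) * M) i j =
      ∑ p, (M (Sum.inl p) i * M (Sum.inr p) j - M (Sum.inr p) i * M (Sum.inl p) j) := by
  have h : (fromBlocks 0 1 (-1) 0 : Matrix (n ⊕ n) (n ⊕ n) ℝ) * M =
      fromBlocks M.toBlocks₂₁ M.toBlocks₂₂ (-M.toBlocks₁₁) (-M.toBlocks₁₂) := by
    conv_lhs => rw [← fromBlocks_toBlocks M, fromBlocks_multiply]
    simp
  rw [Matrix.mul_assoc, h, Matrix.mul_apply, Fintype.sum_sum_type, ← Finset.sum_add_distrib]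
  refine Finset.sum_congr rfl fun p _ => ?_
  rcases j with j | j <;>
    simp [toBlocks₁₁, toBlocks₁₂, toBlocks₂₁, toBlocks₂₂, sub_eq_add_neg]

lemma apply_inl_inl_eq_zero {k m : ℕ} {M : Matrix (FullIdx k m) (FullIdx k m) ℝ}
    (hM : M ∈ SpKL k m) (j : Fin k) :
    (∀ i, M (Sum.inl (Sum.inr i)) (Sum.inl (Sum.inl j)) = 0) ∧
      ∀ i, M (Sum.inr i) (Sum.inl (Sum.inl j)) = 0 :=
  ⟨fun i => hM.2 _ j (by simp [r1]), fun i => hM.2 _ j (by simp [r1])⟩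

/-- The third block row of an element of `Sp(k,ℓ)` is `A₁⁻ᵀ` times that of the identity. -/
lemma blk1_transpose_mul_row {k m : ℕ} {M : Matrix (FullIdx k m) (FullIdx k m) ℝ}
    (hM : M ∈ SpKL k m) :
    (blk1 k m M)ᵀ * M.submatrix (r3 k m) id =
      (1 : Matrix (FullIdx k m) (FullIdx k m) ℝ).submatrix (r3 k m) id := by
  ext i j
  have h := congrFun (congrFun hM.1 (r1 k m i)) j
  rw [Jmat, transpose_mul_J_mul_apply, Fintype.sum_sum_type] at h
  have hz := apply_inl_inl_eq_zero hM i
  simp only [r1, hz.1, hz.2, zero_mul, sub_zero, Finset.sum_const_zero, add_zero] at h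
  rw [Matrix.mul_apply]
  simp only [blk1, r1, r3, transpose_apply, submatrix_apply, id]
  rw [h]
  rcases j with j | j <;> simp [r3, Matrix.one_apply]

lemma isUnit_blk1 {k m : ℕ} {M : Matrix (FullIdx k m) (FullIdx k m) ℝ}
    (hM : M ∈ SpKL k m) : IsUnit (blk1 k m M) := by
  have h : (blk1 k m M)ᵀ * M.submatrix (r3 k m) (r3 k m) = 1 := by
    have h := congrArg (fun X => X.submatrix id (r3 k m)) (blk1_transpose_mul_row hM)
    have h1 : (1 : Matrix (FullIdx k m) (FullIdx k m) ℝ).submatrix (r3 k m) (r3 k m) = 1 :=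
      submatrix_one _ fun a b hab => by simpa [r3] using hab
    rw [← h1]
    exact h
  rw [← Matrix.isUnit_transpose]
  exact IsUnit.of_mul_eq_one _ h

/-- The third block row of an element of `Sp(k,ℓ)` vanishes off the diagonal block. -/
lemma apply_r3_eq_zero {k m : ℕ} {M : Matrix (FullIdx k m) (FullIdx k m) ℝ}
    (hM : M ∈ SpKL k m) (p : Fin k) (j : FullIdx k m) (hj : ∀ q, j ≠ r3 k m q) :
    M (r3 k m p) j = 0 := by
  have hz : (1 : Matrix (FullIdx k m) (FullIdx k m) ℝ).submatrix (r3 k m) (fun _ : Unit => j) =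
      0 := by
    ext q _
    exact Matrix.one_apply_ne (hj q).symm
  have h : (blk1 k m M)ᵀ * M.submatrix (r3 k m) (fun _ : Unit => j) =
      (blk1 k m M)ᵀ * (0 : Matrix (Fin k) Unit ℝ) := by
    rw [Matrix.mul_zero, ← hz]
    exact congrArg (fun X => X.submatrix id (fun _ : Unit => j)) (blk1_transpose_mul_row hM)
  have hu := (Matrix.isUnit_transpose (blk1 k m M)).2 (isUnit_blk1 hM)
  have := hu.invertible
  have h0 := Matrix.mul_right_injective_of_invertible (A := (blk1 k m M)ᵀ) h
  exact congrFun (congrFun h0 p) ()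

lemma apply_r3_embSmall_eq_zero {k m : ℕ} {M : Matrix (FullIdx k m) (FullIdx k m) ℝ}
    (hM : M ∈ SpKL k m) (p : Fin k) (j : Fin m ⊕ Fin m) :
    M (Sum.inr (Sum.inl p)) (embSmall k m j) = 0 :=
  apply_r3_eq_zero hM p _ (by rcases j with j | j <;> simp [r3, embSmall])

lemma one_mem_SpKL (k m : ℕ) : (1 : Matrix (FullIdx k m) (FullIdx k m) ℝ) ∈ SpKL k m :=
  ⟨by simp [SpBig], fun _ j hi => Matrix.one_apply_ne (hi j)⟩

lemma mul_mem_SpKL {k m : ℕ} {M N : Matrix (FullIdx k m) (FullIdx k m) ℝ}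
    (hM : M ∈ SpKL k m) (hN : N ∈ SpKL k m) : M * N ∈ SpKL k m := by
  refine ⟨?_, fun i j hi => ?_⟩
  · have hM1 : Mᵀ * Jmat k m * M = Jmat k m := hM.1
    have hN1 : Nᵀ * Jmat k m * N = Jmat k m := hN.1
    calc (M * N)ᵀ * Jmat k m * (M * N) = Nᵀ * (Mᵀ * Jmat k m * M) * N := by
          simp only [transpose_mul, Matrix.mul_assoc]
      _ = Jmat k m := by rw [hM1, hN1]
  · rw [Matrix.mul_apply]
    refine Finset.sum_eq_zero fun q _ => ?_
    by_cases hq : ∃ p, q = r1 k m p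
    · obtain ⟨p, rfl⟩ := hq
      rw [hM.2 i p hi, zero_mul]
    · rw [hN.2 q j fun p h => hq ⟨p, h⟩, mul_zero]

lemma J_mul_J {n : Type*} [Fintype n] [DecidableEq n] :
    (fromBlocks 0 1 (-1) 0 : Matrix (n ⊕ n) (n ⊕ n) ℝ) * fromBlocks 0 1 (-1) 0 = -1 := by
  have h : (-1 : Matrix (n ⊕ n) (n ⊕ n) ℝ) = fromBlocks (-1) 0 0 (-1) := by
    rw [← fromBlocks_one, fromBlocks_neg, neg_zero]
  rw [fromBlocks_multiply, h]
  simp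

lemma Jmat_mul_self (k m : ℕ) : Jmat k m * Jmat k m = -1 := J_mul_J

lemma neg_J_mul_transpose_mul_J {n : Type*} [Fintype n] [DecidableEq n]
    (M : Matrix (n ⊕ n) (n ⊕ n) ℝ) :
    -((fromBlocks 0 1 (-1) 0 : Matrix (n ⊕ n) (n ⊕ n) ℝ) * Mᵀ * fromBlocks 0 1 (-1) 0) =
      fromBlocks M.toBlocks₂₂ᵀ (-M.toBlocks₁₂ᵀ) (-M.toBlocks₂₁ᵀ) M.toBlocks₁₁ᵀ := by
  conv_lhs => rw [← fromBlocks_toBlocks M, fromBlocks_transpose]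
  simp [fromBlocks_multiply, fromBlocks_neg]

lemma exists_inverse_mem_SpKL {k m : ℕ} {M : Matrix (FullIdx k m) (FullIdx k m) ℝ}
    (hM : M ∈ SpKL k m) : ∃ N ∈ SpKL k m, M * N = 1 ∧ N * M = 1 := by
  have hM1 : Mᵀ * Jmat k m * M = Jmat k m := hM.1
  set N := -(Jmat k m * Mᵀ * Jmat k m) with hN
  have hNM : N * M = 1 := by
    rw [hN, Matrix.neg_mul, Matrix.mul_assoc, Matrix.mul_assoc, ← Matrix.mul_assoc Mᵀ, hM1,
      Jmat_mul_self, neg_neg]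
  have hMN : M * N = 1 := mul_eq_one_comm.1 hNM
  refine ⟨N, ⟨?_, fun i j hi => ?_⟩, hMN, hNM⟩
  · have hT : Nᵀ * Mᵀ = 1 := by rw [← transpose_mul, hMN, transpose_one]
    calc Nᵀ * Jmat k m * N = Nᵀ * (Mᵀ * Jmat k m * M) * N := by rw [hM1]
      _ = (Nᵀ * Mᵀ) * Jmat k m * (M * N) := by simp only [Matrix.mul_assoc]
      _ = Jmat k m := by rw [hT, hMN, Matrix.one_mul, Matrix.mul_one]
  · rw [hN, Jmat, neg_J_mul_transpose_mul_J]
    rcases i with i | i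
    · exact apply_r3_eq_zero hM j (Sum.inr i) fun q h => hi q (by simpa [r1, r3] using h)
    · exact neg_eq_zero.2 (apply_r3_eq_zero hM j (Sum.inl i) (by simp [r3]))

lemma blk2_mem_SpSmall {k m : ℕ} {M : Matrix (FullIdx k m) (FullIdx k m) ℝ}
    (hM : M ∈ SpKL k m) : blk2 k m M ∈ SpSmall m := by
  change _ = _
  ext i j
  have h := congrFun (congrFun hM.1 (embSmall k m i)) (embSmall k m j)
  rw [Jmat, transpose_mul_J_mul_apply, Fintype.sum_sum_type] at h
  simp only [apply_r3_embSmall_eq_zero hM, zero_mul, mul_zero, sub_zero, Finset.sum_const_zero,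
    zero_add] at h
  rw [Jsmall, transpose_mul_J_mul_apply]
  refine h.trans ?_
  rcases i with i | i <;> rcases j with j | j <;> simp [embSmall, Matrix.one_apply]

lemma blk1_mul {k m : ℕ} (M : Matrix (FullIdx k m) (FullIdx k m) ℝ)
    {N : Matrix (FullIdx k m) (FullIdx k m) ℝ} (hN : N ∈ SpKL k m) :
    blk1 k m (M * N) = blk1 k m M * blk1 k m N := by
  ext i j
  have hz := apply_inl_inl_eq_zero hN j
  simp only [blk1, r1, submatrix_apply, Matrix.mul_apply, Fintype.sum_sum_type, hz.1, hz.2,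
    mul_zero, Finset.sum_const_zero, add_zero]

lemma blk2_mul {k m : ℕ} {M N : Matrix (FullIdx k m) (FullIdx k m) ℝ}
    (hM : M ∈ SpKL k m) (hN : N ∈ SpKL k m) :
    blk2 k m (M * N) = blk2 k m M * blk2 k m N := by
  ext i j
  have hz (p : Fin k) : M (embSmall k m i) (Sum.inl (Sum.inl p)) = 0 :=
    hM.2 _ p (by rcases i with i | i <;> simp [r1, embSmall])
  simp only [blk2, submatrix_apply, Matrix.mul_apply, Fintype.sum_sum_type, hz,
    apply_r3_embSmall_eq_zero hN, zero_mul, mul_zero, Finset.sum_const_zero, zero_add]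
  rfl

lemma exists_mem_SpKL_of_blocks {k m : ℕ} {A : Matrix (Fin k) (Fin k) ℝ}
    {S : Matrix (Fin m ⊕ Fin m) (Fin m ⊕ Fin m) ℝ} (hA : IsUnit A) (hS : S ∈ SpSmall m) :
    ∃ M ∈ SpKL k m, blk1 k m M = A ∧ blk2 k m M = S := by
  obtain ⟨a, b, c, d, rfl⟩ : ∃ a b c d, S = fromBlocks a b c d :=
    ⟨_, _, _, _, (fromBlocks_toBlocks S).symm⟩
  have hdet := (Matrix.isUnit_iff_isUnit_det A).1 hA
  have h1 : Aᵀ * (A⁻¹)ᵀ = 1 := by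
    rw [← transpose_mul, Matrix.nonsing_inv_mul A hdet, transpose_one]
  have h2 : A⁻¹ * A = 1 := Matrix.nonsing_inv_mul A hdet
  change _ = _ at hS
  rw [Jsmall] at hS
  simp only [fromBlocks_transpose, fromBlocks_multiply, fromBlocks_inj, Matrix.mul_zero,
    Matrix.mul_one, Matrix.mul_neg, zero_add, add_zero, Matrix.neg_mul] at hS
  obtain ⟨e1, e2, e3, e4⟩ := hS
  refine ⟨fromBlocks (fromBlocks A 0 0 a) (fromBlocks 0 0 0 b) (fromBlocks 0 0 0 c)
    (fromBlocks (A⁻¹)ᵀ 0 0 d), ⟨?_, ?_⟩, ?_, ?_⟩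
  · change _ = _
    rw [Jmat]
    simp only [fromBlocks_transpose, fromBlocks_multiply, fromBlocks_inj, Matrix.mul_zero,
      Matrix.mul_one, Matrix.mul_neg, zero_add, add_zero, Matrix.neg_mul, fromBlocks_neg,
      fromBlocks_add, transpose_zero, transpose_transpose, Matrix.zero_mul, neg_zero,
      e1, e2, e3, e4, h1, h2]
    refine ⟨fromBlocks_zero, fromBlocks_one, ?_, fromBlocks_zero⟩
    rw [← fromBlocks_one, fromBlocks_neg, neg_zero, neg_zero]
  · rintro ((i | i) | (i | i)) j hi
    · exact absurd rfl (hi i)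
    all_goals rfl
  · rfl
  · ext (i | i) (j | j) <;> rfl

/-- `Sp(k,ℓ)` is a subgroup of `Sp(ℓ)`, and
`ϖ : Sp(k,ℓ) → GL(k,ℝ) × Sp(ℓ-k)`, `M ↦ (A₁, A₂)`, is a well defined surjective
group homomorphism. -/
theorem stmt0 (k m : ℕ) (hk : 1 ≤ k) :
    ((1 : Matrix (FullIdx k m) (FullIdx k m) ℝ) ∈ SpKL k m) ∧
    (∀ M ∈ SpKL k m, ∀ N ∈ SpKL k m, M * N ∈ SpKL k m) ∧
    (∀ M ∈ SpKL k m, ∃ N ∈ SpKL k m, M * N = 1 ∧ N * M = 1) ∧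
    (∀ M ∈ SpKL k m, IsUnit (blk1 k m M) ∧ blk2 k m M ∈ SpSmall m) ∧
    (∀ M ∈ SpKL k m, ∀ N ∈ SpKL k m,
      blk1 k m (M * N) = blk1 k m M * blk1 k m N ∧
      blk2 k m (M * N) = blk2 k m M * blk2 k m N) ∧
    (∀ (A : Matrix (Fin k) (Fin k) ℝ) (S : Matrix (Fin m ⊕ Fin m) (Fin m ⊕ Fin m) ℝ),
      IsUnit A → S ∈ SpSmall m →
      ∃ M ∈ SpKL k m, blk1 k m M = A ∧ blk2 k m M = S) := by
  exact ⟨one_mem_SpKL k m, fun _ hM _ hN => mul_mem_SpKL hM hN,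
    fun _ hM => exists_inverse_mem_SpKL hM, fun _ hM => ⟨isUnit_blk1 hM, blk2_mem_SpSmall hM⟩,
    fun _ hM _ hN => ⟨blk1_mul _ hN, blk2_mul hM hN⟩,
    fun _ _ hA hS => exists_mem_SpKL_of_blocks hA hS⟩
end

section
/- The kernel of ϖ consists exactly of those matrices M ∈ Sp(ℓ) whose 4×4 block form (blocks of sizes k, ℓ−k, k, ℓ−k) has identity blocks in positions (1,1), (2,2), (3,3), (4,4) and zero blocks in positions (2,1), (3,1), (4,1), (3,2), (4,2), (2,4), (3,4). Moreover, every such M automatically satisfies M₍₄,₃₎ = −(M₍₁,₂₎)ᵀ and M₍₂,₃₎ = (M₍₁,₄₎)ᵀ. -/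
open Matrix

/-- The symplectic condition, entry by entry. -/
lemma symplectic_entry {k m : ℕ} {M : Matrix (FullIdx k m) (FullIdx k m) ℝ}
    (hM : M ∈ SpBig k m) (a b : FullIdx k m) :
    ∑ i, M (Sum.inl i) a * M (Sum.inr i) b - ∑ i, M (Sum.inr i) a * M (Sum.inl i) b =
      Jmat k m a b := by
  have h : (Mᵀ * Jmat k m * M) a b = Jmat k m a b := by
    rw [show Mᵀ * Jmat k m * M = Jmat k m from hM]
  rw [← h, Matrix.mul_assoc]
  simp only [Matrix.mul_apply, Jmat, Matrix.transpose_apply,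
    Fintype.sum_sum_type (α₁ := HalfIdx k m),
    Matrix.fromBlocks_apply₁₁, Matrix.fromBlocks_apply₁₂, Matrix.fromBlocks_apply₂₁,
    Matrix.fromBlocks_apply₂₂, Matrix.zero_apply, Matrix.neg_apply, zero_mul, neg_mul,
    Finset.sum_neg_distrib, Finset.sum_const_zero, zero_add, add_zero, mul_neg,
    Matrix.one_apply, ite_mul, one_mul, Finset.sum_ite_eq, Finset.mem_univ, if_true, sub_eq_add_neg]

/-- If the first block column of a symplectic matrix is that of the identity, then so is its third
block row. -/
lemma third_row_eq_one {k m : ℕ} {M : Matrix (FullIdx k m) (FullIdx k m) ℝ}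
    (hM : M ∈ SpBig k m) (h : ∀ a j, M a (r1 k m j) = (1 : Matrix _ _ ℝ) a (r1 k m j))
    (j : Fin k) (b : FullIdx k m) :
    M (r3 k m j) b = (1 : Matrix _ _ ℝ) (r3 k m j) b := by
  have e := symplectic_entry hM (r1 k m j) b
  simp only [h] at e
  rcases b with (b | b) | (b | b) <;>
    simpa [r1, r3, Jmat, Matrix.one_apply] using e

lemma kerVarpi_entries {k m : ℕ} {M : Matrix (FullIdx k m) (FullIdx k m) ℝ}
    (hM : M ∈ kerVarpi k m) :
    M ∈ SpBig k m ∧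
    (∀ a j, M a (r1 k m j) = (1 : Matrix _ _ ℝ) a (r1 k m j)) ∧
    (∀ i j, M (embSmall k m i) (embSmall k m j) = (1 : Matrix _ _ ℝ) i j) ∧
    (∀ j b, M (r3 k m j) b = (1 : Matrix _ _ ℝ) (r3 k m j) b) := by
  obtain ⟨⟨hS, h0⟩, h1, h2⟩ := hM
  have hcol : ∀ a j, M a (r1 k m j) = (1 : Matrix _ _ ℝ) a (r1 k m j) := by
    intro a j
    rcases a with (a | a) | (a | a)
    · simpa [Matrix.one_apply, r1, blk1] using congr_fun₂ h1 a j
    all_goals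
      rw [h0 _ j (by simp [r1])]
      simp [r1, Matrix.one_apply]
  exact ⟨hS, hcol, congr_fun₂ h2, third_row_eq_one hS hcol⟩

/-- The kernel of `ϖ` consists exactly of the symplectic matrices
whose block form has identity blocks at positions (1,1), (2,2), (3,3), (4,4) and zero
blocks at (2,1), (3,1), (4,1), (3,2), (4,2), (2,4), (3,4); moreover every such matrix
automatically satisfies `M₄₃ = -(M₁₂)ᵀ` and `M₂₃ = (M₁₄)ᵀ`. -/
theorem stmt1 (k m : ℕ) (hk : 1 ≤ k) :
    (∀ M : Matrix (FullIdx k m) (FullIdx k m) ℝ,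
      M ∈ kerVarpi k m ↔
        (M ∈ SpBig k m ∧
         M.submatrix (r1 k m) (r1 k m) = 1 ∧ M.submatrix (r2 k m) (r2 k m) = 1 ∧
         M.submatrix (r3 k m) (r3 k m) = 1 ∧ M.submatrix (r4 k m) (r4 k m) = 1 ∧
         M.submatrix (r2 k m) (r1 k m) = 0 ∧ M.submatrix (r3 k m) (r1 k m) = 0 ∧
         M.submatrix (r4 k m) (r1 k m) = 0 ∧ M.submatrix (r3 k m) (r2 k m) = 0 ∧
         M.submatrix (r4 k m) (r2 k m) = 0 ∧ M.submatrix (r2 k m) (r4 k m) = 0 ∧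
         M.submatrix (r3 k m) (r4 k m) = 0)) ∧
    (∀ M ∈ kerVarpi k m,
      M.submatrix (r4 k m) (r3 k m) = -(M.submatrix (r1 k m) (r2 k m))ᵀ ∧
      M.submatrix (r2 k m) (r3 k m) = (M.submatrix (r1 k m) (r4 k m))ᵀ) := by
  refine ⟨fun M => ⟨fun hM => ?_, ?_⟩, fun M hM => ?_⟩
  · obtain ⟨hS, h1, h2, h3⟩ := kerVarpi_entries hM
    have h22 := fun i j => h2 (Sum.inl i) (Sum.inl j)
    have h24 := fun i j => h2 (Sum.inl i) (Sum.inr j)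
    have h42 := fun i j => h2 (Sum.inr i) (Sum.inl j)
    have h44 := fun i j => h2 (Sum.inr i) (Sum.inr j)
    simp only [embSmall, Sum.elim_inl, Sum.elim_inr, r1, r3] at h22 h24 h42 h44 h1 h3
    refine ⟨hS, ?_, ?_, ?_, ?_, ?_, ?_, ?_, ?_, ?_, ?_, ?_⟩ <;> ext i j <;>
      simp [r1, r2, r3, r4, h1, h22, h24, h42, h44, h3, Matrix.one_apply]
  · rintro ⟨hS, h11, h22, -, h44, h21, h31, h41, -, h42, h24, -⟩
    refine ⟨⟨hS, ?_⟩, h11, ?_⟩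
    · rintro ((i | i) | (i | i)) j hi
      · exact absurd rfl (hi i)
      · exact congr_fun₂ h21 i j
      · exact congr_fun₂ h31 i j
      · exact congr_fun₂ h41 i j
    · rw [← Matrix.fromBlocks_one]
      ext (i | i) (j | j)
      · exact congr_fun₂ h22 i j
      · exact congr_fun₂ h24 i j
      · exact congr_fun₂ h42 i j
      · exact congr_fun₂ h44 i j
  · obtain ⟨hS, -, h2, h3⟩ := kerVarpi_entries hM
    have h22 := fun i j => h2 (Sum.inl i) (Sum.inl j)
    have h24 := fun i j => h2 (Sum.inl i) (Sum.inr j)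
    have h42 := fun i j => h2 (Sum.inr i) (Sum.inl j)
    have h44 := fun i j => h2 (Sum.inr i) (Sum.inr j)
    simp only [embSmall, Sum.elim_inl, Sum.elim_inr, r3] at h22 h24 h42 h44 h3
    constructor <;> ext i j
    · have e := symplectic_entry hS (r2 k m i) (r3 k m j)
      simp [r2, r3, Jmat, h22, h42, h3, Matrix.one_apply] at e
      simp only [Matrix.submatrix_apply, Matrix.neg_apply, Matrix.transpose_apply, r1, r2, r3, r4]
      linarith
    · have e := symplectic_entry hS (r4 k m i) (r3 k m j)
      simp [r4, r3, Jmat, h24, h44, h3, Matrix.one_apply] at e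
      simp only [Matrix.submatrix_apply, Matrix.transpose_apply, r1, r2, r3, r4]
      linarith
end

section
/- The kernel T = ker(ϖ) has no elements of order two: if M ∈ Sp(k,ℓ) satisfies ϖ(M) = (I_k, I_{2(ℓ−k)}) and M² = I_{2ℓ}, then M = I_{2ℓ}. -/
open Matrix

/-- The first block column of an element of `Sp(k,ℓ)` with `A₁ = 1` is that of the identity. -/
theorem apply_r1_of_mem_SpKL {k m : ℕ} {M : Matrix (FullIdx k m) (FullIdx k m) ℝ}
    (hM : M ∈ SpKL k m) (h1 : blk1 k m M = 1) (x : FullIdx k m) (i : Fin k) :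
    M x (Sum.inl (Sum.inl i)) =
      (1 : Matrix (FullIdx k m) (FullIdx k m) ℝ) x (Sum.inl (Sum.inl i)) := by
  by_cases hx : ∃ i', x = r1 k m i'
  · obtain ⟨i', rfl⟩ := hx
    have h := congrFun (congrFun h1 i') i
    simpa [blk1, r1, one_apply] using h
  · push Not at hx
    exact (hM.2 x i hx).trans (one_apply_ne (hx i)).symm

/-- The third block row of an element of `Sp(k,ℓ)` with `A₁ = 1` is that of the identity. -/
theorem apply_r3_of_mem_SpKL {k m : ℕ} {M : Matrix (FullIdx k m) (FullIdx k m) ℝ}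
    (hM : M ∈ SpKL k m) (h1 : blk1 k m M = 1) (i : Fin k) (j : FullIdx k m) :
    M (Sum.inr (Sum.inl i)) j =
      (1 : Matrix (FullIdx k m) (FullIdx k m) ℝ) (Sum.inr (Sum.inl i)) j := by
  have h := congrFun (congrFun hM.1 (Sum.inl (Sum.inl i))) j
  rw [Matrix.mul_assoc, Matrix.mul_apply] at h
  simp only [transpose_apply, apply_r1_of_mem_SpKL hM h1, one_apply, ite_mul, one_mul,
    zero_mul, Finset.sum_ite_eq', Finset.mem_univ, if_true] at h
  rcases j with (j | j) | (j | j) <;>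
    simpa [Jmat, mul_apply, Fintype.sum_sum_type, one_apply] using h

/-- `T = ker(ϖ)` has no elements of order two: if `M ∈ Sp(k,ℓ)`
satisfies `ϖ(M) = (I, I)` and `M² = I`, then `M = I`. -/
theorem stmt3 (k m : ℕ) (hk : 1 ≤ k) (M : Matrix (FullIdx k m) (FullIdx k m) ℝ)
    (hM : M ∈ SpKL k m) (h1 : blk1 k m M = 1) (h2 : blk2 k m M = 1)
    (hsq : M * M = 1) : M = 1 := by
  obtain ⟨N, rfl⟩ : ∃ N, M = 1 + N := ⟨M - 1, by abel⟩
  have hcol (x : FullIdx k m) (i : Fin k) : N x (Sum.inl (Sum.inl i)) = 0 := by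
    simpa using apply_r1_of_mem_SpKL hM h1 x i
  have hrow (i : Fin k) (x : FullIdx k m) : N (Sum.inr (Sum.inl i)) x = 0 := by
    simpa using apply_r3_of_mem_SpKL hM h1 i x
  have hmid (a b : Fin m ⊕ Fin m) : N (embSmall k m a) (embSmall k m b) = 0 := by
    have h := congrFun (congrFun h2 a) b
    rcases a with a | a <;> rcases b with b | b <;>
      simpa [blk2, embSmall, one_apply] using h
  have h22 (a b : Fin m) : N (Sum.inl (Sum.inr a)) (Sum.inl (Sum.inr b)) = 0 :=
    hmid (Sum.inl a) (Sum.inl b)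
  have h24 (a b : Fin m) : N (Sum.inl (Sum.inr a)) (Sum.inr (Sum.inr b)) = 0 :=
    hmid (Sum.inl a) (Sum.inr b)
  have h42 (a b : Fin m) : N (Sum.inr (Sum.inr a)) (Sum.inl (Sum.inr b)) = 0 :=
    hmid (Sum.inr a) (Sum.inl b)
  have h44 (a b : Fin m) : N (Sum.inr (Sum.inr a)) (Sum.inr (Sum.inr b)) = 0 :=
    hmid (Sum.inr a) (Sum.inr b)
  have hNN : N * N = (-2 : ℝ) • N := by
    have h : N * N = (1 + N) * (1 + N) - 1 - (2 : ℝ) • N := by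
      rw [two_smul]; noncomm_ring
    rw [h, hsq, sub_self, zero_sub, neg_smul]
  have hN3 : N * N * N = 0 := by
    ext i j
    rcases i with (i | i) | (i | i) <;> rcases j with (j | j) | (j | j) <;>
      simp [mul_apply, Fintype.sum_sum_type, hcol, hrow, h22, h24, h42, h44]
  have h4 : (4 : ℝ) • N = 0 := by
    rw [← hN3, hNN, smul_mul_assoc, hNN, smul_smul]
    norm_num
  rw [(smul_eq_zero.mp h4).resolve_left (by norm_num), add_zero]
end

section
/- Sp₊(k,ℓ), endowed with the subspace topology inherited from the space of 2ℓ×2ℓ real matrices, is a connected topological space. -/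
open Matrix

/-- Real square matrices with positive determinant. -/
def posDet (n : Type*) [Fintype n] [DecidableEq n] : Set (Matrix n n ℝ) := {A | 0 < A.det}

/-- If a set of matrices is closed under multiplication, so is the path component of `1` in it. -/
theorem joinedIn_one_mul {n : Type*} [Fintype n] [DecidableEq n] {S : Set (Matrix n n ℝ)}
    (hS : ∀ A ∈ S, ∀ B ∈ S, A * B ∈ S) {A B : Matrix n n ℝ}
    (hA : JoinedIn S A 1) (hB : JoinedIn S B 1) : JoinedIn S (A * B) 1 := by
  have h : JoinedIn S (A * B) (1 * 1) :=
    (hA.mul hB).mono (Set.mul_subset_iff.2 hS)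
  simpa using h

/-- The matrix acting by the matrix `W` on the coordinates `i`, `j` and trivially on the others. -/
def planeMatrix {n : Type*} [DecidableEq n] (i j : n) (W : Matrix (Fin 2) (Fin 2) ℝ) :
    Matrix n n ℝ :=
  1 + (1 : Matrix n n ℝ).submatrix id ![i, j] * (W - 1) * (1 : Matrix n n ℝ).submatrix ![i, j] id

theorem det_planeMatrix {n : Type*} [Fintype n] [DecidableEq n] {i j : n} (hij : i ≠ j)
    (W : Matrix (Fin 2) (Fin 2) ℝ) : (planeMatrix i j W).det = W.det := by
  have hinj : Function.Injective ![i, j] := by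
    intro a b
    fin_cases a <;> fin_cases b <;> simp [hij, hij.symm]
  rw [planeMatrix, Matrix.mul_assoc, det_one_add_mul_comm, Matrix.mul_assoc,
    ← submatrix_mul _ _ _ id _ Function.bijective_id, Matrix.mul_one, submatrix_one _ hinj,
    Matrix.mul_one, add_sub_cancel]

theorem planeMatrix_neg_one {n : Type*} [Fintype n] [DecidableEq n] {i j : n} (hij : i ≠ j) :
    planeMatrix i j (-1) = diagonal fun a => if a = i ∨ a = j then -1 else 1 := by
  ext a b
  simp only [planeMatrix, Matrix.add_apply, Matrix.mul_apply, Fin.sum_univ_two, one_apply,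
    submatrix_apply, id, diagonal_apply, Matrix.sub_apply, Matrix.neg_apply]
  by_cases h1 : a = i <;> by_cases h2 : a = j <;> by_cases h3 : a = b <;>
    simp_all [eq_comm]

theorem joinedIn_planeMatrix_neg_one {n : Type*} [Fintype n] [DecidableEq n] {i j : n}
    (hij : i ≠ j) : JoinedIn (posDet n) (planeMatrix i j (-1)) 1 := by
  let W : ℝ → Matrix (Fin 2) (Fin 2) ℝ := fun t =>
    !![Real.cos t, -Real.sin t; Real.sin t, Real.cos t]
  have hW : Continuous W := by
    refine continuous_matrix fun a b => ?_
    fin_cases a <;> fin_cases b <;> simp [W] <;> fun_prop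
  have h : JoinedIn (posDet n) (planeMatrix i j (W (Real.pi * 0)))
      (planeMatrix i j (W (Real.pi * 1))) := by
    refine JoinedIn.ofLine (f := fun t => planeMatrix i j (W (Real.pi * t))) ?_ rfl rfl ?_
    · refine Continuous.continuousOn ?_
      unfold planeMatrix
      fun_prop
    · rintro _ ⟨t, -, rfl⟩
      simp [posDet, det_planeMatrix hij, W, det_fin_two, ← pow_two]
  have h0 : W (Real.pi * 0) = 1 := by simp [W, Matrix.one_fin_two]
  have h1 : W (Real.pi * 1) = -1 := by simp [W, Matrix.one_fin_two]
  rw [h0, h1] at h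
  have h2 : planeMatrix i j 1 = 1 := by
    rw [planeMatrix, sub_self, Matrix.mul_zero, Matrix.zero_mul, add_zero]
  rw [h2] at h
  exact h.symm

theorem joinedIn_diagonal {n : Type*} [Fintype n] [DecidableEq n] (D : n → ℝ)
    (hD : 0 < ∏ a, D a) : JoinedIn (posDet n) (diagonal D) 1 := by
  induction hc : (Finset.univ.filter fun a => D a < 0).card using Nat.strong_induction_on
    generalizing D with
  | _ c ih =>
    have hne : ∀ a, D a ≠ 0 := fun a h => hD.ne' (Finset.prod_eq_zero (Finset.mem_univ a) h)
    by_cases hneg : ∃ i, D i < 0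
    · obtain ⟨i, hi⟩ := hneg
      obtain ⟨j, hij, hj⟩ : ∃ j, i ≠ j ∧ D j < 0 := by
        by_contra! hcon
        have h1 : 0 < ∏ a ∈ Finset.univ.erase i, D a := Finset.prod_pos fun a ha =>
          lt_of_le_of_ne (hcon a (Finset.ne_of_mem_erase ha).symm) (hne a).symm
        rw [← Finset.mul_prod_erase _ _ (Finset.mem_univ i)] at hD
        nlinarith
      let E : n → ℝ := fun a => if a = i ∨ a = j then -1 else 1
      have hE : diagonal E = planeMatrix i j (-1) := (planeMatrix_neg_one hij).symm
      have hEprod : ∏ a, E a = 1 := by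
        rw [← det_diagonal, hE, det_planeMatrix hij]
        simp [det_fin_two]
      have hEE : ∀ a, D a * E a * E a = D a := fun a => by
        by_cases h : a = i ∨ a = j <;> simp [E, h]
      have h := ih _ ?_ (fun a => D a * E a) ?_ rfl
      · have h2 := joinedIn_one_mul (S := posDet n)
          (fun A hA B hB => by simpa [posDet] using mul_pos hA hB) h
          (joinedIn_planeMatrix_neg_one hij)
        rw [← hE, diagonal_mul_diagonal] at h2
        simpa [hEE] using h2
      · rw [← hc]
        refine Finset.card_lt_card (Finset.ssubset_iff_of_subset ?_ |>.2 ⟨i, ?_, ?_⟩)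
        · intro a
          by_cases h : a = i ∨ a = j
          · rcases h with rfl | rfl <;> simp [hi, hj]
          · simp [E, h]
        · simpa using hi
        · simpa [E] using hi.le
      · rw [Finset.prod_mul_distrib, hEprod, mul_one]
        exact hD
    · push Not at hneg
      have hpos : ∀ a, 0 < D a := fun a => lt_of_le_of_ne (hneg a) (hne a).symm
      refine JoinedIn.ofLine (f := fun t => diagonal fun a => (1 - t) * D a + t) ?_ ?_ ?_ ?_
      · exact Continuous.continuousOn (by fun_prop)
      · simp
      · simp
      · rintro _ ⟨t, ⟨ht0, ht1⟩, rfl⟩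
        simp only [posDet, Set.mem_ofPred_eq, det_diagonal]
        refine Finset.prod_pos fun a _ => ?_
        rcases ht0.eq_or_lt with rfl | h
        · simpa using hpos a
        · have := mul_nonneg (sub_nonneg.2 ht1) (hpos a).le
          linarith

/-- The group of real matrices with positive determinant is path connected. -/
theorem joinedIn_posDet {n : Type*} [Fintype n] [DecidableEq n] (A : Matrix n n ℝ)
    (hA : 0 < A.det) : JoinedIn (posDet n) A 1 := by
  refine diagonal_transvection_induction (fun M => JoinedIn (posDet n) M 1) A ?_ ?_ ?_
  · intro D hD
    exact joinedIn_diagonal D (by rwa [← det_diagonal, hD])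
  · intro t
    refine JoinedIn.ofLine (f := fun s => transvection t.i t.j ((1 - s) * t.c)) ?_ ?_ ?_ ?_
    · unfold transvection
      refine Continuous.continuousOn (continuous_const.add (continuous_matrix fun a b => ?_))
      simp only [single_apply]
      split_ifs <;> fun_prop
    · simp [TransvectionStruct.toMatrix]
    · simp
    · rintro _ ⟨s, -, rfl⟩
      simp [posDet, det_transvection_of_ne _ _ t.hij]
  · exact fun A B hA hB => joinedIn_one_mul
      (fun A hA B hB => by simpa [posDet] using mul_pos hA hB) hA hB

theorem toBlocks₁₁_one {p q : Type*} [DecidableEq p] [DecidableEq q] :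
    (1 : Matrix (p ⊕ q) (p ⊕ q) ℝ).toBlocks₁₁ = 1 := by
  rw [← fromBlocks_one, toBlocks_fromBlocks₁₁]

theorem toBlocks₂₁_one {p q : Type*} [DecidableEq p] [DecidableEq q] :
    (1 : Matrix (p ⊕ q) (p ⊕ q) ℝ).toBlocks₂₁ = 0 := by
  rw [← fromBlocks_one, toBlocks_fromBlocks₂₁]

theorem fromBlocks_mem_SpPlus_iff {k m : ℕ} {A B C D : Matrix (HalfIdx k m) (HalfIdx k m) ℝ} :
    fromBlocks A B C D ∈ SpPlus k m ↔
      (Aᵀ * C = Cᵀ * A ∧ Bᵀ * D = Dᵀ * B ∧ Aᵀ * D - Cᵀ * B = 1) ∧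
      (A.toBlocks₂₁ = 0 ∧ C.toBlocks₁₁ = 0 ∧ C.toBlocks₂₁ = 0) ∧ 0 < A.toBlocks₁₁.det := by
  have h1 : fromBlocks A B C D ∈ SpBig k m ↔
      Aᵀ * C = Cᵀ * A ∧ Bᵀ * D = Dᵀ * B ∧ Aᵀ * D - Cᵀ * B = 1 := by
    simp only [SpBig, Jmat, Set.mem_ofPred_eq, fromBlocks_transpose, fromBlocks_multiply,
      fromBlocks_inj, Matrix.mul_zero, Matrix.mul_one, Matrix.mul_neg, zero_add, add_zero,
      Matrix.neg_mul]
    constructor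
    · rintro ⟨h1, h2, -, h4⟩
      refine ⟨?_, ?_, ?_⟩
      · rw [← sub_eq_zero, ← h1]; abel
      · rw [← sub_eq_zero, ← h4]; abel
      · rw [← h2]; abel
    · rintro ⟨h1, h2, h3⟩
      have h3' := congrArg transpose h3
      simp only [transpose_sub, transpose_mul, transpose_transpose, transpose_one] at h3'
      refine ⟨by rw [h1]; abel, by rw [← h3]; abel, by rw [← h3']; abel, by rw [h2]; abel⟩
  have h2 : (∀ (i : FullIdx k m) (j : Fin k), (∀ i' : Fin k, i ≠ r1 k m i') →
      fromBlocks A B C D i (r1 k m j) = 0) ↔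
      (A.toBlocks₂₁ = 0 ∧ C.toBlocks₁₁ = 0 ∧ C.toBlocks₂₁ = 0) := by
    simp [r1, Sum.forall, ← Matrix.ext_iff, toBlocks₂₁, toBlocks₁₁]
  have h3 : blk1 k m (fromBlocks A B C D) = A.toBlocks₁₁ := rfl
  rw [← h1, ← h2, ← h3]
  simp only [SpPlus, SpKL, Set.mem_ofPred_eq, and_assoc]

theorem SpPlus_mul_mem {k m : ℕ} (M : Matrix (FullIdx k m) (FullIdx k m) ℝ) (hM : M ∈ SpPlus k m)
    (N : Matrix (FullIdx k m) (FullIdx k m) ℝ) (hN : N ∈ SpPlus k m) : M * N ∈ SpPlus k m := by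
  obtain ⟨⟨hM1, hM2⟩, hM3⟩ := hM
  obtain ⟨⟨hN1, hN2⟩, hN3⟩ := hN
  have key : ∀ i j, (M * N) i (r1 k m j) = ∑ a, M i (r1 k m a) * N (r1 k m a) (r1 k m j) := by
    intro i j
    have h0 : ∀ a, N (Sum.inl (Sum.inr a)) (r1 k m j) = 0 := fun a => hN2 _ _ (by simp [r1])
    have h1 : ∀ a, N (Sum.inr a) (r1 k m j) = 0 := fun a => hN2 _ _ (by simp [r1])
    simp only [r1] at h0 h1
    simp [Matrix.mul_apply, Fintype.sum_sum_type, h0, h1, r1]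
  refine ⟨⟨?_, fun i j hi => ?_⟩, ?_⟩
  · simp only [SpBig, Set.mem_ofPred_eq] at *
    rw [transpose_mul]
    calc Nᵀ * Mᵀ * Jmat k m * (M * N) = Nᵀ * (Mᵀ * Jmat k m * M) * N := by
          simp only [Matrix.mul_assoc]
      _ = _ := by rw [hM1, hN1]
  · rw [key]
    exact Finset.sum_eq_zero fun a _ => by rw [hM2 i a hi, zero_mul]
  · have : blk1 k m (M * N) = blk1 k m M * blk1 k m N := by
      ext i j
      exact key _ _
    rw [this, det_mul]
    exact mul_pos hM3 hN3

theorem joinedIn_lower {k m : ℕ} {S : Matrix (HalfIdx k m) (HalfIdx k m) ℝ} (hS : Sᵀ = S)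
    (h1 : S.toBlocks₁₁ = 0) (h2 : S.toBlocks₂₁ = 0) :
    JoinedIn (SpPlus k m) (fromBlocks 1 0 S 1) 1 := by
  refine JoinedIn.ofLine (f := fun t => fromBlocks 1 0 ((1 - t) • S) 1) ?_ ?_ ?_ ?_
  · exact Continuous.continuousOn (by fun_prop)
  · simp
  · simp
  · rintro _ ⟨t, -, rfl⟩
    rw [fromBlocks_mem_SpPlus_iff]
    have e1 : ((1 - t) • S).toBlocks₁₁ = (1 - t) • S.toBlocks₁₁ := rfl
    have e2 : ((1 - t) • S).toBlocks₂₁ = (1 - t) • S.toBlocks₂₁ := rfl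
    simp [hS, h1, h2, e1, e2, toBlocks₁₁_one, toBlocks₂₁_one]

theorem joinedIn_upper {k m : ℕ} {T : Matrix (HalfIdx k m) (HalfIdx k m) ℝ} (hT : Tᵀ = T) :
    JoinedIn (SpPlus k m) (fromBlocks 1 T 0 1) 1 := by
  refine JoinedIn.ofLine (f := fun t => fromBlocks 1 ((1 - t) • T) 0 1) ?_ ?_ ?_ ?_
  · exact Continuous.continuousOn (by fun_prop)
  · simp
  · simp
  · rintro _ ⟨t, -, rfl⟩
    rw [fromBlocks_mem_SpPlus_iff]
    have e1 : (0 : Matrix (HalfIdx k m) (HalfIdx k m) ℝ).toBlocks₁₁ = 0 := rfl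
    have e2 : (0 : Matrix (HalfIdx k m) (HalfIdx k m) ℝ).toBlocks₂₁ = 0 := rfl
    simp [hT, e1, e2, toBlocks₁₁_one, toBlocks₂₁_one]

/-- Invertible block upper triangular matrices whose diagonal blocks have positive determinant are
joined to `1` among themselves. -/
theorem joinedIn_blockTriangular {p q : Type*} [Fintype p] [DecidableEq p] [Fintype q]
    [DecidableEq q] {a : Matrix p p ℝ} (b : Matrix p q ℝ) {d : Matrix q q ℝ}
    (ha : 0 < a.det) (hd : 0 < d.det) :
    JoinedIn {A : Matrix (p ⊕ q) (p ⊕ q) ℝ |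
      A.toBlocks₂₁ = 0 ∧ 0 < A.toBlocks₁₁.det ∧ 0 < A.toBlocks₂₂.det} (fromBlocks a b 0 d) 1 := by
  have h1 : JoinedIn {A : Matrix (p ⊕ q) (p ⊕ q) ℝ |
      A.toBlocks₂₁ = 0 ∧ 0 < A.toBlocks₁₁.det ∧ 0 < A.toBlocks₂₂.det}
      (fromBlocks a b 0 d) (fromBlocks a 0 0 d) := by
    refine JoinedIn.ofLine (f := fun t => fromBlocks a ((1 - t) • b) 0 d) ?_ ?_ ?_ ?_
    · exact Continuous.continuousOn (by fun_prop)
    · simp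
    · simp
    · rintro _ ⟨t, -, rfl⟩
      simp [ha, hd]
  refine h1.trans ?_
  have h2 := ((joinedIn_posDet a ha).prod (joinedIn_posDet d hd)).map
    (f := fun x : Matrix p p ℝ × Matrix q q ℝ => fromBlocks x.1 0 0 x.2) (by fun_prop)
  rw [fromBlocks_one] at h2
  refine h2.mono ?_
  rintro _ ⟨x, ⟨hx1, hx2⟩, rfl⟩
  exact ⟨by simp, hx1, hx2⟩

theorem joinedIn_levi {k m : ℕ} {A : Matrix (HalfIdx k m) (HalfIdx k m) ℝ}
    (h21 : A.toBlocks₂₁ = 0) (h11 : 0 < A.toBlocks₁₁.det) (h22 : 0 < A.toBlocks₂₂.det) :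
    JoinedIn (SpPlus k m) (fromBlocks A 0 0 A⁻¹ᵀ) 1 := by
  have h := joinedIn_blockTriangular A.toBlocks₁₂ h11 h22
  have hA : fromBlocks A.toBlocks₁₁ A.toBlocks₁₂ 0 A.toBlocks₂₂ = A := by
    rw [← h21, fromBlocks_toBlocks]
  rw [hA] at h
  have hdet : ∀ B : Matrix (HalfIdx k m) (HalfIdx k m) ℝ,
      B.toBlocks₂₁ = 0 ∧ 0 < B.toBlocks₁₁.det ∧ 0 < B.toBlocks₂₂.det → B.det ≠ 0 := by
    rintro B ⟨h1, h2, h3⟩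
    rw [← fromBlocks_toBlocks B, h1, det_fromBlocks_zero₂₁]
    exact (mul_pos h2 h3).ne'
  have h' := h.map_continuousOn (f := fun B => fromBlocks B 0 0 B⁻¹ᵀ) ?_
  · rw [inv_one, transpose_one, fromBlocks_one] at h'
    refine h'.mono ?_
    rintro _ ⟨B, hB, rfl⟩
    have e1 : (0 : Matrix (HalfIdx k m) (HalfIdx k m) ℝ).toBlocks₁₁ = 0 := rfl
    have e2 : (0 : Matrix (HalfIdx k m) (HalfIdx k m) ℝ).toBlocks₂₁ = 0 := rfl
    have hBB : Bᵀ * B⁻¹ᵀ = 1 := by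
      rw [← transpose_mul, nonsing_inv_mul _ (isUnit_iff_ne_zero.2 (hdet B hB)), transpose_one]
    rw [fromBlocks_mem_SpPlus_iff, hBB]
    simp [hB.1, hB.2.1, e1, e2]
  · have hinv : ContinuousOn (fun B : Matrix (HalfIdx k m) (HalfIdx k m) ℝ => B⁻¹)
        {B | B.toBlocks₂₁ = 0 ∧ 0 < B.toBlocks₁₁.det ∧ 0 < B.toBlocks₂₂.det} := by
      simp only [inv_def, Ring.inverse_eq_inv']
      exact (ContinuousOn.inv₀ (by fun_prop) hdet).smul (by fun_prop)
    have hc : Continuous fun x : Matrix (HalfIdx k m) (HalfIdx k m) ℝ ×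
        Matrix (HalfIdx k m) (HalfIdx k m) ℝ => fromBlocks x.1 0 0 x.2ᵀ := by fun_prop
    exact hc.comp_continuousOn (continuousOn_id.prodMk hinv)

/-- The diagonal matrix which changes the sign of one coordinate of the second block. -/
def signFlip (k : ℕ) {m : ℕ} (j : Fin m) : Matrix (HalfIdx k m) (HalfIdx k m) ℝ :=
  diagonal fun a => if a = Sum.inr j then -1 else 1

theorem joinedIn_signFlip (k : ℕ) {m : ℕ} (j : Fin m) :
    JoinedIn (SpPlus k m) (fromBlocks (signFlip k j) 0 0 (signFlip k j)) 1 := by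
  let c : ℝ → HalfIdx k m → ℝ := fun t a => if a = Sum.inr j then Real.cos (Real.pi * t) else 1
  let s : ℝ → HalfIdx k m → ℝ := fun t a => if a = Sum.inr j then Real.sin (Real.pi * t) else 0
  refine JoinedIn.symm (JoinedIn.ofLine (f := fun t => fromBlocks (diagonal (c t))
    (diagonal (s t)) (-diagonal (s t)) (diagonal (c t))) ?_ ?_ ?_ ?_)
  · have hc : Continuous c := continuous_pi fun a => by
      simp only [c]
      split_ifs <;> fun_prop
    have hs : Continuous s := continuous_pi fun a => by
      simp only [s]
      split_ifs <;> fun_prop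
    exact Continuous.continuousOn (by fun_prop)
  · simp [c, s]
  · simp [c, s, signFlip]
  · rintro _ ⟨t, -, rfl⟩
    have hcs : ∀ a, c t a * c t a + s t a * s t a = 1 := fun a => by
      by_cases h : a = Sum.inr j <;> simp [c, s, h, ← pow_two]
    have h11 : (diagonal (c t)).toBlocks₁₁ = 1 := by
      ext a b
      simp [toBlocks₁₁, diagonal_apply, one_apply, c]
    have hs11 : (-diagonal (s t)).toBlocks₁₁ = 0 := by
      ext a b
      simp [toBlocks₁₁, diagonal_apply, s]
    rw [fromBlocks_mem_SpPlus_iff, h11, hs11]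
    refine ⟨⟨?_, ?_, ?_⟩, ⟨?_, rfl, ?_⟩, by simp⟩
    · simp [diagonal_mul_diagonal, mul_comm]
    · simp [diagonal_mul_diagonal, mul_comm]
    · simp [diagonal_mul_diagonal, hcs]
    · ext a b
      simp [toBlocks₂₁]
    · ext a b
      simp [toBlocks₂₁]

/-- If the pencil `A + z B` is singular for all real `z`, then it is singular at `z = I`. -/
theorem exists_mulVec_eq_of_forall_det_eq_zero {n : Type*} [Fintype n] [DecidableEq n]
    {A B : Matrix n n ℝ} (h : ∀ t : ℝ, (A + t • B).det = 0) :
    ∃ x y : n → ℝ, (x ≠ 0 ∨ y ≠ 0) ∧ A *ᵥ x = B *ᵥ y ∧ A *ᵥ y = -(B *ᵥ x) := by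
  let p : Polynomial ℝ := (A.map Polynomial.C + (Polynomial.X : Polynomial ℝ) •
    B.map Polynomial.C).det
  have hp : p = 0 := Polynomial.funext fun t => by
    rw [Polynomial.eval_zero, ← h t, ← Polynomial.coe_evalRingHom, RingHom.map_det]
    congr 1
    ext i j
    simp
    ring
  have hI : (A.map Complex.ofReal + Complex.I • B.map Complex.ofReal).det = 0 := by
    have h2 : Polynomial.aeval Complex.I p = 0 := by rw [hp, map_zero]
    rw [← h2, ← AlgHom.coe_toRingHom, RingHom.map_det]
    congr 1
    ext i j
    simp
    ring
  obtain ⟨v, hv, hv0⟩ := exists_mulVec_eq_zero_iff.2 hI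
  refine ⟨fun a => (v a).re, fun a => (v a).im, ?_, ?_, ?_⟩
  · by_contra! hcon
    exact hv (funext fun a => Complex.ext (congrFun hcon.1 a) (congrFun hcon.2 a))
  · ext i
    have := congrArg Complex.re (congrFun hv0 i)
    simp [mulVec, dotProduct, add_mul, Finset.sum_add_distrib] at this ⊢
    linarith
  · ext i
    have := congrArg Complex.im (congrFun hv0 i)
    simp [mulVec, dotProduct, add_mul, Finset.sum_add_distrib] at this ⊢
    linarith

theorem exists_det_add_smul_ne_zero {k m : ℕ} {A B C D : Matrix (HalfIdx k m) (HalfIdx k m) ℝ}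
    (h : fromBlocks A B C D ∈ SpPlus k m) :
    ∃ t : ℝ, (A + t • (B * fromBlocks 0 0 0 1)).det ≠ 0 := by
  by_contra! hcon
  obtain ⟨x, y, hxy, hx, hy⟩ := exists_mulVec_eq_of_forall_det_eq_zero hcon
  set P : Matrix (HalfIdx k m) (HalfIdx k m) ℝ := fromBlocks 0 0 0 1
  have hform : ∀ X Y : FullIdx k m → ℝ, X ⬝ᵥ (Jmat k m *ᵥ Y) =
      (fromBlocks A B C D *ᵥ X) ⬝ᵥ (Jmat k m *ᵥ (fromBlocks A B C D *ᵥ Y)) := by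
    intro X Y
    have h1 : (fromBlocks A B C D)ᵀ * Jmat k m * fromBlocks A B C D = Jmat k m := h.1.1
    conv_lhs => rw [← h1]
    rw [← mulVec_mulVec, ← mulVec_mulVec, dotProduct_mulVec, vecMul_transpose]
  have hP : ∀ z : HalfIdx k m → ℝ, P *ᵥ z = Sum.elim (fun _ => 0) (z ∘ Sum.inr) := by
    intro z
    simp only [P, fromBlocks_mulVec, zero_mulVec, one_mulVec, zero_add]
    rfl
  have key := hform (Sum.elim x (-(P *ᵥ y))) (Sum.elim y (P *ᵥ x))
  have hMX : A *ᵥ x + B *ᵥ (-(P *ᵥ y)) = 0 := by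
    rw [hx, mulVec_neg, mulVec_mulVec, add_neg_cancel]
  have hMY : A *ᵥ y + B *ᵥ (P *ᵥ x) = 0 := by
    rw [hy, mulVec_mulVec, neg_add_cancel]
  simp only [Jmat, fromBlocks_mulVec, Sum.elim_comp_inl, Sum.elim_comp_inr, hMX, hMY, zero_mulVec,
    one_mulVec, neg_mulVec, mulVec_zero, sumElim_dotProduct_sumElim, zero_add, add_zero,
    zero_dotProduct, dotProduct_zero] at key
  have hsum : ∑ i : Fin m, (x (Sum.inr i) ^ 2 + y (Sum.inr i) ^ 2) = 0 := by
    rw [← key, hP, hP, Finset.sum_add_distrib]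
    simp [dotProduct, Fintype.sum_sum_type, pow_two]
  have hxy0 : ∀ i : Fin m, x (Sum.inr i) = 0 ∧ y (Sum.inr i) = 0 := by
    intro i
    have := (Finset.sum_eq_zero_iff_of_nonneg fun i _ => by positivity).1 hsum i (Finset.mem_univ i)
    constructor <;> nlinarith
  obtain ⟨-, ⟨hA21, -, -⟩, hA11⟩ := fromBlocks_mem_SpPlus_iff.1 h
  have hker : ∀ z : HalfIdx k m → ℝ, (∀ i, z (Sum.inr i) = 0) → A *ᵥ z = 0 → z = 0 := by
    intro z hz hAz
    have h1 : A.toBlocks₁₁ *ᵥ (z ∘ Sum.inl) = 0 := by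
      ext i
      have := congrFun hAz (Sum.inl i)
      simpa [mulVec, dotProduct, Fintype.sum_sum_type, hz, toBlocks₁₁] using this
    have h2 := eq_zero_of_mulVec_eq_zero hA11.ne' h1
    ext (i | i)
    · exact congrFun h2 i
    · exact hz i
  have hPz : ∀ z : HalfIdx k m → ℝ, (∀ i, z (Sum.inr i) = 0) → (B * P) *ᵥ z = 0 := by
    intro z hz
    have : P *ᵥ z = 0 := by
      rw [hP]
      ext (i | i) <;> simp [hz]
    rw [← mulVec_mulVec, this, mulVec_zero]
  have hx0 := hker x (fun i => (hxy0 i).1) (by rw [hx, hPz y fun i => (hxy0 i).2])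
  have hy0 := hker y (fun i => (hxy0 i).2) (by rw [hy, hPz x fun i => (hxy0 i).1, neg_zero])
  exact hxy.elim (fun h => h hx0) (fun h => h hy0)

/-- To join `M` to `1`, one may first multiply it by an element of the identity component. -/
theorem joinedIn_SpPlus_of_mul {k m : ℕ} {M N : Matrix (FullIdx k m) (FullIdx k m) ℝ}
    (hM : M ∈ SpPlus k m) (hN : JoinedIn (SpPlus k m) N 1)
    (h : JoinedIn (SpPlus k m) (M * N) 1) : JoinedIn (SpPlus k m) M 1 := by
  have h1 : JoinedIn (SpPlus k m) (M * N) (M * 1) :=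
    (hN.map (f := fun X => M * X) (by fun_prop)).mono
      (Set.image_subset_iff.2 fun X hX => SpPlus_mul_mem M hM X hX)
  rw [Matrix.mul_one] at h1
  exact h1.symm.trans h

theorem joinedIn_SpPlus_of_det_pos {k m : ℕ} {A B C D : Matrix (HalfIdx k m) (HalfIdx k m) ℝ}
    (h : fromBlocks A B C D ∈ SpPlus k m) (h22 : 0 < A.toBlocks₂₂.det) :
    JoinedIn (SpPlus k m) (fromBlocks A B C D) 1 := by
  obtain ⟨⟨hAC, -, -⟩, ⟨hA21, hC11, hC21⟩, hA11⟩ := fromBlocks_mem_SpPlus_iff.1 h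
  have hAblocks : A = fromBlocks A.toBlocks₁₁ A.toBlocks₁₂ 0 A.toBlocks₂₂ := by
    rw [← hA21, fromBlocks_toBlocks]
  have hCblocks : C = fromBlocks 0 C.toBlocks₁₂ 0 C.toBlocks₂₂ := by
    conv_lhs => rw [← fromBlocks_toBlocks C, hC11, hC21]
  have hdet : IsUnit A.det := by
    rw [hAblocks, det_fromBlocks_zero₂₁]
    exact (mul_pos hA11 h22).ne'.isUnit
  have hAinv := nonsing_inv_mul A hdet
  have hinvA := mul_nonsing_inv A hdet
  have hAinvT : A⁻¹ᵀ * Aᵀ = 1 := by rw [← transpose_mul, hinvA, transpose_one]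
  set S := C * A⁻¹ with hS
  have hSA : S * A = C := by rw [hS, Matrix.mul_assoc, hAinv, Matrix.mul_one]
  have hSsymm : Sᵀ = S := by
    calc Sᵀ = A⁻¹ᵀ * (Cᵀ * A) * A⁻¹ := by
          rw [hS, transpose_mul]
          simp only [Matrix.mul_assoc, hinvA, Matrix.mul_one]
      _ = A⁻¹ᵀ * Aᵀ * C * A⁻¹ := by rw [← hAC]; simp only [Matrix.mul_assoc]
      _ = S := by rw [hAinvT, Matrix.one_mul]
  have hSblocks : S = fromBlocks 0 S.toBlocks₁₂ 0 S.toBlocks₂₂ := by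
    have hu : IsUnit A.toBlocks₁₁ ↔ IsUnit A.toBlocks₂₂ := by
      simp [isUnit_iff_isUnit_det, hA11.ne', h22.ne']
    have hS' : S = fromBlocks 0 C.toBlocks₁₂ 0 C.toBlocks₂₂ *
        (fromBlocks A.toBlocks₁₁ A.toBlocks₁₂ 0 A.toBlocks₂₂)⁻¹ := by
      rw [← hAblocks, ← hCblocks]
    rw [inv_fromBlocks_zero₂₁_of_isUnit_iff _ _ _ hu, fromBlocks_multiply] at hS'
    rw [hS']
    simp
  have hL : ∀ X : Matrix (HalfIdx k m) (HalfIdx k m) ℝ, X = S ∨ X = -S →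
      JoinedIn (SpPlus k m) (fromBlocks 1 0 X 1) 1 := by
    rintro X (rfl | rfl)
    · exact joinedIn_lower hSsymm (by rw [hSblocks]; simp) (by rw [hSblocks]; simp)
    · exact joinedIn_lower (by rw [transpose_neg, hSsymm])
        (by rw [hSblocks, fromBlocks_neg]; simp) (by rw [hSblocks, fromBlocks_neg]; simp)
  have hred := SpPlus_mul_mem _ (hL (-S) (Or.inr rfl)).source_mem _ h
  have hred' : fromBlocks 1 0 (-S) 1 * fromBlocks A B C D = fromBlocks A B 0 (D - S * B) := by
    simp [fromBlocks_multiply, hSA, sub_eq_neg_add]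
  rw [hred'] at hred
  obtain ⟨⟨-, hBE, hAE⟩, -, -⟩ := fromBlocks_mem_SpPlus_iff.1 hred
  set E := D - S * B with hE
  have hE' : E = A⁻¹ᵀ := by
    rw [transpose_zero, Matrix.zero_mul, sub_zero] at hAE
    rw [← Matrix.one_mul E, ← hAinvT, Matrix.mul_assoc, hAE, Matrix.mul_one]
  have hT : (A⁻¹ * B)ᵀ = A⁻¹ * B := by
    rw [transpose_mul, ← hE', hBE, hE', transpose_transpose]
  have hdecomp : fromBlocks A B C D =
      fromBlocks 1 0 S 1 * (fromBlocks A 0 0 A⁻¹ᵀ * fromBlocks 1 (A⁻¹ * B) 0 1) := by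
    simp [fromBlocks_multiply, ← Matrix.mul_assoc, hinvA, hSA, ← hE', hE]
  rw [hdecomp]
  exact joinedIn_one_mul SpPlus_mul_mem (hL S (Or.inl rfl))
    (joinedIn_one_mul SpPlus_mul_mem (joinedIn_levi hA21 hA11 h22) (joinedIn_upper hT))

theorem joinedIn_SpPlus_of_det_ne_zero {k m : ℕ} {A B C D : Matrix (HalfIdx k m) (HalfIdx k m) ℝ}
    (h : fromBlocks A B C D ∈ SpPlus k m) (hdet : A.det ≠ 0) :
    JoinedIn (SpPlus k m) (fromBlocks A B C D) 1 := by
  obtain ⟨-, ⟨hA21, -, -⟩, hA11⟩ := fromBlocks_mem_SpPlus_iff.1 h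
  have h22 : A.toBlocks₂₂.det ≠ 0 := by
    rw [← fromBlocks_toBlocks A, hA21, det_fromBlocks_zero₂₁] at hdet
    exact right_ne_zero_of_mul hdet
  rcases h22.lt_or_gt with hneg | hpos
  · obtain ⟨j⟩ : Nonempty (Fin m) := by
      by_contra hm
      rw [not_nonempty_iff] at hm
      rw [det_isEmpty] at hneg
      linarith
    have hmul := SpPlus_mul_mem _ h _ (joinedIn_signFlip k j).source_mem
    have hflip : (A * signFlip k j).toBlocks₂₂ =
        A.toBlocks₂₂ * diagonal fun a => if a = j then -1 else 1 := by
      ext a b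
      simp [signFlip, toBlocks₂₂, mul_diagonal]
    refine joinedIn_SpPlus_of_mul h (joinedIn_signFlip k j) ?_
    rw [fromBlocks_multiply] at hmul ⊢
    refine joinedIn_SpPlus_of_det_pos hmul ?_
    rw [Matrix.mul_zero, add_zero, hflip, det_mul, det_diagonal, Finset.prod_ite_eq']
    simpa using hneg
  · exact joinedIn_SpPlus_of_det_pos h hpos

theorem joinedIn_SpPlus_one {k m : ℕ} {M : Matrix (FullIdx k m) (FullIdx k m) ℝ}
    (hM : M ∈ SpPlus k m) : JoinedIn (SpPlus k m) M 1 := by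
  obtain ⟨A, B, C, D, rfl⟩ : ∃ A B C D, M = fromBlocks A B C D :=
    ⟨_, _, _, _, (fromBlocks_toBlocks M).symm⟩
  obtain ⟨t, ht⟩ := exists_det_add_smul_ne_zero hM
  have hL : JoinedIn (SpPlus k m) (fromBlocks 1 0 (t • fromBlocks 0 0 0 1) 1) 1 :=
    joinedIn_lower (by simp [fromBlocks_transpose]) (by simp [fromBlocks_smul])
      (by simp [fromBlocks_smul])
  refine joinedIn_SpPlus_of_mul hM hL ?_
  have hmul := SpPlus_mul_mem _ hM _ hL.source_mem
  rw [fromBlocks_multiply] at hmul ⊢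
  refine joinedIn_SpPlus_of_det_ne_zero hmul ?_
  rwa [Matrix.mul_one, Matrix.mul_smul]

/-- `Sp₊(k,ℓ)`, with the subspace topology inherited from the space
of `2ℓ × 2ℓ` real matrices, is connected. -/
theorem stmt5 (k m : ℕ) (hk : 1 ≤ k) : ConnectedSpace ↥(SpPlus k m) := by
  have hone : (1 : Matrix (FullIdx k m) (FullIdx k m) ℝ) ∈ SpPlus k m :=
    (joinedIn_upper (transpose_zero (m := HalfIdx k m))).target_mem
  have hpath : IsPathConnected (SpPlus k m) :=
    ⟨1, hone, fun _ hM => (joinedIn_SpPlus_one hM).symm⟩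
  exact isConnected_iff_connectedSpace.1 hpath.isConnected
end

section
/- The kernel of γ consists exactly of those matrices M ∈ Sp(ℓ) whose 4×4 block form has identity blocks in positions (2,2) and (4,4), zero blocks in positions (2,1), (3,1), (4,1), (2,4), (4,2), and whose block M₍₁,₁₎ has positive determinant. Moreover, every such M automatically satisfies M₍₃,₂₎ = 0, M₍₃,₄₎ = 0, M₍₃,₃₎ = (M₍₁,₁₎ᵀ)⁻¹ and M₍₄,₃₎ = −(M₍₁,₁₎⁻¹ M₍₁,₂₎)ᵀ. -/
open Matrix

theorem blk2_eq_one_iff {k m : ℕ} (M : Matrix (FullIdx k m) (FullIdx k m) ℝ) :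
    blk2 k m M = 1 ↔
      M.submatrix (r2 k m) (r2 k m) = 1 ∧ M.submatrix (r2 k m) (r4 k m) = 0 ∧
      M.submatrix (r4 k m) (r2 k m) = 0 ∧ M.submatrix (r4 k m) (r4 k m) = 1 := by
  have h : blk2 k m M = fromBlocks (M.submatrix (r2 k m) (r2 k m)) (M.submatrix (r2 k m) (r4 k m))
      (M.submatrix (r4 k m) (r2 k m)) (M.submatrix (r4 k m) (r4 k m)) := by
    ext (i | i) (j | j) <;> rfl
  rw [h, ← fromBlocks_one, fromBlocks_inj]

theorem mem_SpKL_iff {k m : ℕ} (M : Matrix (FullIdx k m) (FullIdx k m) ℝ) :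
    M ∈ SpKL k m ↔ M ∈ SpBig k m ∧ M.submatrix (r2 k m) (r1 k m) = 0 ∧
      M.submatrix (r3 k m) (r1 k m) = 0 ∧ M.submatrix (r4 k m) (r1 k m) = 0 := by
  refine and_congr_right fun _ => ⟨fun h => ⟨?_, ?_, ?_⟩, ?_⟩
  · ext i j
    exact h _ j (by simp [r1, r2])
  · ext i j
    exact h _ j (by simp [r1, r3])
  · ext i j
    exact h _ j (by simp [r1, r4])
  · rintro ⟨h2, h3, h4⟩ ((i | i) | (i | i)) j hi
    · exact absurd rfl (hi i)
    · exact congrFun (congrFun h2 i) j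
    · exact congrFun (congrFun h3 i) j
    · exact congrFun (congrFun h4 i) j

theorem mem_kerGamma_iff {k m : ℕ} (M : Matrix (FullIdx k m) (FullIdx k m) ℝ) :
    M ∈ kerGamma k m ↔
      (M ∈ SpBig k m ∧
       M.submatrix (r2 k m) (r2 k m) = 1 ∧ M.submatrix (r4 k m) (r4 k m) = 1 ∧
       M.submatrix (r2 k m) (r1 k m) = 0 ∧ M.submatrix (r3 k m) (r1 k m) = 0 ∧
       M.submatrix (r4 k m) (r1 k m) = 0 ∧ M.submatrix (r2 k m) (r4 k m) = 0 ∧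
       M.submatrix (r4 k m) (r2 k m) = 0 ∧
       0 < (M.submatrix (r1 k m) (r1 k m)).det) := by
  change (M ∈ SpKL k m ∧ 0 < (M.submatrix (r1 k m) (r1 k m)).det) ∧ blk2 k m M = 1 ↔ _
  rw [mem_SpKL_iff, blk2_eq_one_iff]
  tauto

theorem relations_of_fromBlocks_mem_SpBig {k m : ℕ}
    {A B C D : Matrix (HalfIdx k m) (HalfIdx k m) ℝ} (h : fromBlocks A B C D ∈ SpBig k m) :
    Aᵀ * C = Cᵀ * A ∧ Aᵀ * D - Cᵀ * B = 1 := by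
  have h' : (fromBlocks A B C D)ᵀ * Jmat k m * fromBlocks A B C D = Jmat k m := h
  rw [Jmat, fromBlocks_transpose, fromBlocks_multiply, fromBlocks_multiply, fromBlocks_inj] at h'
  obtain ⟨h₁, h₂, -, -⟩ := h'
  simp only [Matrix.mul_zero, Matrix.mul_one, Matrix.mul_neg, Matrix.neg_mul, zero_add, add_zero]
    at h₁ h₂
  constructor
  · rw [← sub_eq_zero, ← h₁]
    abel
  · rw [← h₂]
    abel

theorem fromBlocks_submatrix {k m : ℕ} (M : Matrix (FullIdx k m) (FullIdx k m) ℝ) :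
    M = fromBlocks
      (fromBlocks (M.submatrix (r1 k m) (r1 k m)) (M.submatrix (r1 k m) (r2 k m))
        (M.submatrix (r2 k m) (r1 k m)) (M.submatrix (r2 k m) (r2 k m)))
      (fromBlocks (M.submatrix (r1 k m) (r3 k m)) (M.submatrix (r1 k m) (r4 k m))
        (M.submatrix (r2 k m) (r3 k m)) (M.submatrix (r2 k m) (r4 k m)))
      (fromBlocks (M.submatrix (r3 k m) (r1 k m)) (M.submatrix (r3 k m) (r2 k m))
        (M.submatrix (r4 k m) (r1 k m)) (M.submatrix (r4 k m) (r2 k m)))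
      (fromBlocks (M.submatrix (r3 k m) (r3 k m)) (M.submatrix (r3 k m) (r4 k m))
        (M.submatrix (r4 k m) (r3 k m)) (M.submatrix (r4 k m) (r4 k m))) := by
  ext ((i | i) | (i | i)) ((j | j) | (j | j)) <;> rfl

/-- `ker(γ)` consists exactly of the symplectic matrices with
identity blocks at (2,2) and (4,4), zero blocks at (2,1), (3,1), (4,1), (2,4), (4,2),
and with `det M₁₁ > 0`; moreover every such matrix automatically satisfies
`M₃₂ = 0`, `M₃₄ = 0`, `M₃₃ = (M₁₁ᵀ)⁻¹` and `M₄₃ = -(M₁₁⁻¹ M₁₂)ᵀ`. -/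
theorem stmt6 (k m : ℕ) (hk : 1 ≤ k) :
    (∀ M : Matrix (FullIdx k m) (FullIdx k m) ℝ,
      M ∈ kerGamma k m ↔
        (M ∈ SpBig k m ∧
         M.submatrix (r2 k m) (r2 k m) = 1 ∧ M.submatrix (r4 k m) (r4 k m) = 1 ∧
         M.submatrix (r2 k m) (r1 k m) = 0 ∧ M.submatrix (r3 k m) (r1 k m) = 0 ∧
         M.submatrix (r4 k m) (r1 k m) = 0 ∧ M.submatrix (r2 k m) (r4 k m) = 0 ∧
         M.submatrix (r4 k m) (r2 k m) = 0 ∧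
         0 < (M.submatrix (r1 k m) (r1 k m)).det)) ∧
    (∀ M ∈ kerGamma k m,
      M.submatrix (r3 k m) (r2 k m) = 0 ∧ M.submatrix (r3 k m) (r4 k m) = 0 ∧
      M.submatrix (r3 k m) (r3 k m) = ((M.submatrix (r1 k m) (r1 k m))ᵀ)⁻¹ ∧
      M.submatrix (r4 k m) (r3 k m)
        = -((M.submatrix (r1 k m) (r1 k m))⁻¹ * M.submatrix (r1 k m) (r2 k m))ᵀ) := by
  refine ⟨mem_kerGamma_iff, fun M hM => ?_⟩
  obtain ⟨hSp, h22, h44, h21, h31, h41, -, h42, hdet⟩ := (mem_kerGamma_iff M).1 hM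
  rw [fromBlocks_submatrix M, h22, h44, h21, h31, h41, h42] at hSp
  obtain ⟨hAC, hAD⟩ := relations_of_fromBlocks_mem_SpBig hSp
  generalize M.submatrix (r1 k m) (r1 k m) = a at *
  have ha : IsUnit aᵀ.det := by
    rw [det_transpose]
    exact hdet.ne'.isUnit
  simp only [fromBlocks_transpose, fromBlocks_multiply, fromBlocks_inj] at hAC
  have h32 : M.submatrix (r3 k m) (r2 k m) = 0 := by
    have h : aᵀ * M.submatrix (r3 k m) (r2 k m) = 0 := by simpa using hAC.2.1
    simpa [nonsing_inv_mul_cancel_left _ _ ha] using congrArg (aᵀ⁻¹ * ·) h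
  rw [h32] at hAD
  simp only [fromBlocks_zero, transpose_zero, Matrix.zero_mul, sub_zero, fromBlocks_transpose,
    fromBlocks_multiply, ← fromBlocks_one, fromBlocks_inj, add_zero, transpose_one,
    Matrix.one_mul] at hAD
  obtain ⟨h₁, h₂, h₃, -⟩ := hAD
  have h33 : M.submatrix (r3 k m) (r3 k m) = aᵀ⁻¹ := (inv_eq_right_inv h₁).symm
  refine ⟨h32, ?_, h33, ?_⟩
  · simpa [nonsing_inv_mul_cancel_left _ _ ha] using congrArg (aᵀ⁻¹ * ·) h₂
  · rw [transpose_mul, transpose_nonsing_inv, ← h33]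
    exact eq_neg_of_add_eq_zero_right h₃
end

section
/- Let ζ : GL(k,ℝ) → Sp(ℓ) send A to the block-diagonal matrix with diagonal blocks (A, I_{ℓ−k}, (Aᵀ)⁻¹, I_{ℓ−k}), and let χ : Sp(ℓ−k) → Sp(ℓ) be the block embedding sending [[A₁,A₂],[A₃,A₄]] to [[I_k,0,0,0],[0,A₁,0,A₂],[0,0,I_k,0],[0,A₃,0,A₄]]. Then ζ and χ are injective group homomorphisms with images contained in Sp(k,ℓ), every element of the image of ζ commutes with every element of the image of χ, and the map o : GL(k,ℝ) × Sp(ℓ−k) → Sp(k,ℓ), (A,h) ↦ ζ(A)·χ(h), is an injective group homomorphism satisfying ϖ ∘ o = id. -/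
open Matrix

/-- The block embedding `ψ : Sp(ℓ-k) → Sp(ℓ)`,
`[[A₁,A₂],[A₃,A₄]] ↦ [[I,0,0,0],[0,A₁,0,A₂],[0,0,I,0],[0,A₃,0,A₄]]`. -/
def psi (k m : ℕ) (S : Matrix (Fin m ⊕ Fin m) (Fin m ⊕ Fin m) ℝ) :
    Matrix (FullIdx k m) (FullIdx k m) ℝ :=
  Matrix.fromBlocks
    (Matrix.fromBlocks 1 0 0 (S.submatrix Sum.inl Sum.inl))
    (Matrix.fromBlocks 0 0 0 (S.submatrix Sum.inl Sum.inr))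
    (Matrix.fromBlocks 0 0 0 (S.submatrix Sum.inr Sum.inl))
    (Matrix.fromBlocks 1 0 0 (S.submatrix Sum.inr Sum.inr))

/-- The embedding `ζ : GL(k,ℝ) → Sp(ℓ)`, `A ↦ diag(A, I, (Aᵀ)⁻¹, I)`. -/
noncomputable def zeta (k m : ℕ) (A : Matrix (Fin k) (Fin k) ℝ) :
    Matrix (FullIdx k m) (FullIdx k m) ℝ :=
  Matrix.fromBlocks (Matrix.fromBlocks A 0 0 1) 0 0 (Matrix.fromBlocks (Aᵀ)⁻¹ 0 0 1)

theorem zeta_mul {k m : ℕ} (A A' : Matrix (Fin k) (Fin k) ℝ) :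
    zeta k m (A * A') = zeta k m A * zeta k m A' := by
  simp [zeta, Matrix.fromBlocks_multiply, Matrix.transpose_mul, Matrix.mul_inv_rev]

theorem psi_fromBlocks {k m : ℕ} (a b c d : Matrix (Fin m) (Fin m) ℝ) :
    psi k m (fromBlocks a b c d) =
      fromBlocks (fromBlocks 1 0 0 a) (fromBlocks 0 0 0 b)
        (fromBlocks 0 0 0 c) (fromBlocks 1 0 0 d) := rfl

theorem psi_mul {k m : ℕ} (S S' : Matrix (Fin m ⊕ Fin m) (Fin m ⊕ Fin m) ℝ) :
    psi k m (S * S') = psi k m S * psi k m S' := by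
  rw [← fromBlocks_toBlocks S, ← fromBlocks_toBlocks S']
  simp [psi_fromBlocks, Matrix.fromBlocks_multiply, Matrix.fromBlocks_add]

theorem zeta_mul_psi_fromBlocks {k m : ℕ} (A : Matrix (Fin k) (Fin k) ℝ)
    (a b c d : Matrix (Fin m) (Fin m) ℝ) :
    zeta k m A * psi k m (fromBlocks a b c d) =
      fromBlocks (fromBlocks A 0 0 a) (fromBlocks 0 0 0 b)
        (fromBlocks 0 0 0 c) (fromBlocks (Aᵀ)⁻¹ 0 0 d) := by
  simp [zeta, psi_fromBlocks, Matrix.fromBlocks_multiply]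

theorem zeta_mul_psi_comm {k m : ℕ} (A : Matrix (Fin k) (Fin k) ℝ)
    (S : Matrix (Fin m ⊕ Fin m) (Fin m ⊕ Fin m) ℝ) :
    zeta k m A * psi k m S = psi k m S * zeta k m A := by
  rw [← fromBlocks_toBlocks S]
  simp [zeta, psi_fromBlocks, Matrix.fromBlocks_multiply]

theorem zeta_one {k m : ℕ} : zeta k m 1 = 1 := by
  simp [zeta]

theorem psi_one {k m : ℕ} : psi k m 1 = 1 := by
  rw [← fromBlocks_one, psi_fromBlocks]
  simp

theorem one_mem_SpSmall {m : ℕ} : 1 ∈ SpSmall m := by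
  simp [SpSmall]

theorem blk1_zeta_mul_psi {k m : ℕ} (A : Matrix (Fin k) (Fin k) ℝ)
    (S : Matrix (Fin m ⊕ Fin m) (Fin m ⊕ Fin m) ℝ) :
    blk1 k m (zeta k m A * psi k m S) = A := by
  rw [← fromBlocks_toBlocks S, zeta_mul_psi_fromBlocks]
  rfl

theorem blk2_zeta_mul_psi {k m : ℕ} (A : Matrix (Fin k) (Fin k) ℝ)
    (S : Matrix (Fin m ⊕ Fin m) (Fin m ⊕ Fin m) ℝ) :
    blk2 k m (zeta k m A * psi k m S) = S := by
  rw [← fromBlocks_toBlocks S, zeta_mul_psi_fromBlocks]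
  ext (i | i) (j | j) <;> rfl

theorem zeta_mul_psi_mem_SpKL {k m : ℕ} {A : Matrix (Fin k) (Fin k) ℝ}
    {S : Matrix (Fin m ⊕ Fin m) (Fin m ⊕ Fin m) ℝ} (hA : IsUnit A) (hS : S ∈ SpSmall m) :
    zeta k m A * psi k m S ∈ SpKL k m := by
  obtain ⟨a, b, c, d, rfl⟩ : ∃ a b c d, S = fromBlocks a b c d :=
    ⟨_, _, _, _, (fromBlocks_toBlocks S).symm⟩
  have hdet : IsUnit A.det := (Matrix.isUnit_iff_isUnit_det A).1 hA
  have hdet' : IsUnit Aᵀ.det := by rwa [det_transpose]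
  have h₁ : Aᵀ * (Aᵀ)⁻¹ = 1 := mul_nonsing_inv _ hdet'
  have h₂ : A⁻¹ * A = 1 := nonsing_inv_mul _ hdet
  simp only [SpSmall, Jsmall, Set.mem_ofPred_eq, fromBlocks_transpose, fromBlocks_multiply,
    fromBlocks_inj, mul_zero, mul_one, mul_neg, zero_add, add_zero] at hS
  obtain ⟨e₁, e₂, e₃, e₄⟩ := hS
  rw [zeta_mul_psi_fromBlocks]
  refine ⟨?_, ?_⟩
  · simp only [SpBig, Jmat, Set.mem_ofPred_eq, fromBlocks_transpose, fromBlocks_multiply,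
      fromBlocks_neg, fromBlocks_add, mul_zero, mul_one, mul_neg, zero_add, add_zero,
      neg_zero, neg_mul, transpose_zero, transpose_nonsing_inv, transpose_transpose,
      ← fromBlocks_one, h₁, h₂, fromBlocks_inj] at *
    simp_all
  · rintro ((i | i) | (i | i)) j hi
    · exact absurd rfl (hi i)
    all_goals rfl

/-- `ζ` and `χ = ψ` are injective group homomorphisms into
`Sp(k,ℓ)`, their images commute elementwise, and
`o : GL(k,ℝ) × Sp(ℓ-k) → Sp(k,ℓ)`, `(A,h) ↦ ζ(A)·χ(h)`, is an injective group
homomorphism with `ϖ ∘ o = id`. -/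
theorem stmt8 (k m : ℕ) (hk : 1 ≤ k) :
    (∀ A : Matrix (Fin k) (Fin k) ℝ, IsUnit A → zeta k m A ∈ SpKL k m) ∧
    (∀ A A' : Matrix (Fin k) (Fin k) ℝ, IsUnit A → IsUnit A' →
      zeta k m (A * A') = zeta k m A * zeta k m A') ∧
    (∀ A A' : Matrix (Fin k) (Fin k) ℝ, IsUnit A → IsUnit A' →
      zeta k m A = zeta k m A' → A = A') ∧
    (∀ S ∈ SpSmall m, psi k m S ∈ SpKL k m) ∧
    (∀ S ∈ SpSmall m, ∀ S' ∈ SpSmall m, psi k m (S * S') = psi k m S * psi k m S') ∧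
    (∀ S ∈ SpSmall m, ∀ S' ∈ SpSmall m, psi k m S = psi k m S' → S = S') ∧
    (∀ (A : Matrix (Fin k) (Fin k) ℝ), ∀ S ∈ SpSmall m, IsUnit A →
      zeta k m A * psi k m S = psi k m S * zeta k m A) ∧
    (∀ (A A' : Matrix (Fin k) (Fin k) ℝ), ∀ S ∈ SpSmall m, ∀ S' ∈ SpSmall m,
      IsUnit A → IsUnit A' →
      zeta k m (A * A') * psi k m (S * S')
        = (zeta k m A * psi k m S) * (zeta k m A' * psi k m S')) ∧
    (∀ (A A' : Matrix (Fin k) (Fin k) ℝ), ∀ S ∈ SpSmall m, ∀ S' ∈ SpSmall m,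
      IsUnit A → IsUnit A' →
      zeta k m A * psi k m S = zeta k m A' * psi k m S' → A = A' ∧ S = S') ∧
    (∀ (A : Matrix (Fin k) (Fin k) ℝ), ∀ S ∈ SpSmall m, IsUnit A →
      zeta k m A * psi k m S ∈ SpKL k m ∧
      blk1 k m (zeta k m A * psi k m S) = A ∧
      blk2 k m (zeta k m A * psi k m S) = S) := by
  have hζ (A : Matrix (Fin k) (Fin k) ℝ) : zeta k m A * psi k m 1 = zeta k m A := by
    rw [psi_one, mul_one]
  have hψ (S : Matrix (Fin m ⊕ Fin m) (Fin m ⊕ Fin m) ℝ) :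
      zeta k m 1 * psi k m S = psi k m S := by
    rw [zeta_one, one_mul]
  have inj (A A' : Matrix (Fin k) (Fin k) ℝ) (S S' : Matrix (Fin m ⊕ Fin m) (Fin m ⊕ Fin m) ℝ)
      (h : zeta k m A * psi k m S = zeta k m A' * psi k m S') : A = A' ∧ S = S' :=
    ⟨by simpa only [blk1_zeta_mul_psi] using congrArg (blk1 k m) h,
      by simpa only [blk2_zeta_mul_psi] using congrArg (blk2 k m) h⟩
  refine ⟨fun A hA => ?_, fun A A' _ _ => zeta_mul A A', fun A A' _ _ h => ?_, fun S hS => ?_,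
    fun S _ S' _ => psi_mul S S', fun S _ S' _ h => ?_, fun A S _ _ => zeta_mul_psi_comm A S,
    fun A A' S _ S' _ _ _ => ?_, fun A A' S _ S' _ _ _ => inj A A' S S',
    fun A S hS hA =>
      ⟨zeta_mul_psi_mem_SpKL hA hS, blk1_zeta_mul_psi A S, blk2_zeta_mul_psi A S⟩⟩
  · exact hζ A ▸ zeta_mul_psi_mem_SpKL hA one_mem_SpSmall
  · exact (inj A A' 1 1 (by rwa [hζ, hζ])).1
  · exact hψ S ▸ zeta_mul_psi_mem_SpKL isUnit_one hS
  · exact (inj 1 1 S S' (by rwa [hψ, hψ])).2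
  · rw [zeta_mul, psi_mul, mul_assoc, ← mul_assoc (zeta k m A'), zeta_mul_psi_comm A' S]
    simp only [mul_assoc]
end

section
/- The intersection Sp(k,ℓ) ∩ u(U(ℓ)) equals {u(D(A,Z)) : A ∈ O(k), Z ∈ U(ℓ−k)}; consequently the map (A,Z) ↦ u(D(A,Z)) is a group isomorphism from O(k) × U(ℓ−k) onto Sp(k,ℓ) ∩ u(U(ℓ)). -/
open Matrix

/-- The standard embedding `u : U(ℓ) → Sp(ℓ)`, sending `X + iY` to `[[X,-Y],[Y,X]]`. -/
def uMap (k m : ℕ) (Z : Matrix (HalfIdx k m) (HalfIdx k m) ℂ) :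
    Matrix (FullIdx k m) (FullIdx k m) ℝ :=
  Matrix.fromBlocks (Z.map Complex.re) (-(Z.map Complex.im))
    (Z.map Complex.im) (Z.map Complex.re)

/-- The block-diagonal complex matrix `D(A,Z)` with diagonal blocks `A` and `Z`. -/
def Dmat (k m : ℕ) (A : Matrix (Fin k) (Fin k) ℝ) (Z : Matrix (Fin m) (Fin m) ℂ) :
    Matrix (HalfIdx k m) (HalfIdx k m) ℂ :=
  Matrix.fromBlocks (A.map fun x => (x : ℂ)) 0 0 Z

/-- The map `u` is multiplicative. -/
theorem uMap_mul (k m : ℕ) (Z W : Matrix (HalfIdx k m) (HalfIdx k m) ℂ) :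
    uMap k m (Z * W) = uMap k m Z * uMap k m W := by
  rw [uMap, uMap, uMap, fromBlocks_multiply, fromBlocks_inj]
  refine ⟨?_, ?_, ?_, ?_⟩ <;> ext i j <;>
    simp only [map_apply, Matrix.neg_apply, Matrix.add_apply, mul_apply, Complex.re_sum,
      Complex.im_sum, Complex.mul_re, Complex.mul_im, ← Finset.sum_add_distrib,
      ← Finset.sum_neg_distrib] <;>
    exact Finset.sum_congr rfl fun _ _ => by ring

/-- The map `u` is injective. -/
theorem uMap_injective (k m : ℕ) : Function.Injective (uMap k m) := by
  intro Z W h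
  obtain ⟨hre, -, him, -⟩ := fromBlocks_inj.1 h
  ext i j
  exact Complex.ext (congrFun (congrFun hre i) j) (congrFun (congrFun him i) j)

/-- The map `u` turns conjugate transposes into transposes. -/
theorem uMap_conjTranspose (k m : ℕ) (Z : Matrix (HalfIdx k m) (HalfIdx k m) ℂ) :
    uMap k m Zᴴ = (uMap k m Z)ᵀ := by
  rw [uMap, uMap, fromBlocks_transpose, fromBlocks_inj]
  refine ⟨?_, ?_, ?_, ?_⟩ <;> ext i j <;> simp

theorem uMap_neg_I (k m : ℕ) :
    uMap k m (-Complex.I • (1 : Matrix (HalfIdx k m) (HalfIdx k m) ℂ)) = Jmat k m := by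
  rw [uMap, Jmat, fromBlocks_inj]
  refine ⟨?_, ?_, ?_, ?_⟩ <;> ext i j <;> by_cases h : i = j <;> simp [h, one_apply]

/-- The map `u` sends unitary matrices to symplectic matrices. -/
theorem uMap_mem_SpBig {k m : ℕ} {Z : Matrix (HalfIdx k m) (HalfIdx k m) ℂ}
    (hZ : Z ∈ unitaryGroup (HalfIdx k m) ℂ) : uMap k m Z ∈ SpBig k m := by
  have h : Zᴴ * Z = 1 := mem_unitaryGroup_iff'.1 hZ
  change (uMap k m Z)ᵀ * Jmat k m * uMap k m Z = Jmat k m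
  rw [← uMap_neg_I, ← uMap_conjTranspose, ← uMap_mul, ← uMap_mul, Matrix.mul_smul, Matrix.mul_one,
    Matrix.smul_mul, h]

theorem Dmat_mul (k m : ℕ) (A A' : Matrix (Fin k) (Fin k) ℝ) (Z Z' : Matrix (Fin m) (Fin m) ℂ) :
    Dmat k m (A * A') (Z * Z') = Dmat k m A Z * Dmat k m A' Z' := by
  rw [Dmat, Dmat, Dmat, fromBlocks_multiply, fromBlocks_inj]
  refine ⟨?_, ?_, ?_, ?_⟩ <;> ext i j <;> simp [mul_apply]

theorem Dmat_one (k m : ℕ) : Dmat k m 1 1 = 1 := by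
  rw [Dmat, ← fromBlocks_one, fromBlocks_inj]
  refine ⟨?_, rfl, rfl, rfl⟩
  ext i j
  by_cases h : i = j <;> simp [h, one_apply]

theorem Dmat_conjTranspose (k m : ℕ) (A : Matrix (Fin k) (Fin k) ℝ)
    (Z : Matrix (Fin m) (Fin m) ℂ) : (Dmat k m A Z)ᴴ = Dmat k m Aᵀ Zᴴ := by
  rw [Dmat, Dmat, fromBlocks_conjTranspose, fromBlocks_inj]
  refine ⟨?_, ?_, ?_, ?_⟩ <;> ext i j <;> simp

theorem Dmat_inj {k m : ℕ} {A A' : Matrix (Fin k) (Fin k) ℝ} {Z Z' : Matrix (Fin m) (Fin m) ℂ}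
    (h : Dmat k m A Z = Dmat k m A' Z') : A = A' ∧ Z = Z' := by
  obtain ⟨hA, -, -, hZ⟩ := fromBlocks_inj.1 h
  refine ⟨?_, hZ⟩
  ext i j
  exact Complex.ofReal_injective (congrFun (congrFun hA i) j)

/-- `D(A,Z)` is unitary exactly when `A` is orthogonal and `Z` is unitary. -/
theorem Dmat_mem_unitaryGroup_iff {k m : ℕ} {A : Matrix (Fin k) (Fin k) ℝ}
    {Z : Matrix (Fin m) (Fin m) ℂ} :
    Dmat k m A Z ∈ unitaryGroup (HalfIdx k m) ℂ ↔
      A ∈ orthogonalGroup (Fin k) ℝ ∧ Z ∈ unitaryGroup (Fin m) ℂ := by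
  rw [mem_unitaryGroup_iff', mem_orthogonalGroup_iff', mem_unitaryGroup_iff', star_eq_conjTranspose,
    star_eq_conjTranspose, Dmat_conjTranspose, ← Dmat_mul, ← Dmat_one]
  exact ⟨Dmat_inj, fun ⟨hA, hZ⟩ => by rw [hA, hZ]⟩

theorem uMap_Dmat_mem_SpKL {k m : ℕ} {A : Matrix (Fin k) (Fin k) ℝ}
    {Z : Matrix (Fin m) (Fin m) ℂ} (h : Dmat k m A Z ∈ unitaryGroup (HalfIdx k m) ℂ) :
    uMap k m (Dmat k m A Z) ∈ SpKL k m := by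
  refine ⟨uMap_mem_SpBig h, ?_⟩
  rintro ((i | i) | (i | i)) j hi
  · exact absurd rfl (hi i)
  all_goals simp [uMap, Dmat, r1]

/-- A block upper triangular unitary matrix is block diagonal. -/
theorem toBlocks₁₂_eq_zero_of_mem_unitaryGroup {m n : Type*} [Fintype m] [Fintype n]
    [DecidableEq m] [DecidableEq n] {M : Matrix (m ⊕ n) (m ⊕ n) ℂ}
    (hM : M ∈ unitaryGroup (m ⊕ n) ℂ) (h : M.toBlocks₂₁ = 0) : M.toBlocks₁₂ = 0 := by
  have hM' := mem_unitaryGroup_iff'.1 hM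
  rw [← fromBlocks_toBlocks M, h, star_eq_conjTranspose, fromBlocks_conjTranspose,
    fromBlocks_multiply, ← fromBlocks_one, fromBlocks_inj] at hM'
  obtain ⟨h₁₁, h₁₂, -, -⟩ := hM'
  simp only [conjTranspose_zero, Matrix.zero_mul, add_zero] at h₁₁ h₁₂
  rw [← Matrix.one_mul M.toBlocks₁₂, ← mul_eq_one_comm.1 h₁₁, Matrix.mul_assoc, h₁₂,
    Matrix.mul_zero]

/-- A unitary matrix whose image under `u` lies in `Sp(k,ℓ)` is of the form `D(A,Z)`. -/
theorem exists_eq_Dmat_of_uMap_mem_SpKL {k m : ℕ} {Z : Matrix (HalfIdx k m) (HalfIdx k m) ℂ}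
    (hZ : Z ∈ unitaryGroup (HalfIdx k m) ℂ) (h : uMap k m Z ∈ SpKL k m) :
    ∃ A W, Z = Dmat k m A W := by
  have him (i : HalfIdx k m) (j : Fin k) : (Z i (Sum.inl j)).im = 0 :=
    h.2 (Sum.inr i) j fun _ => Sum.inr_ne_inl
  have hre (i : Fin m) (j : Fin k) : (Z (Sum.inr i) (Sum.inl j)).re = 0 :=
    h.2 (Sum.inl (Sum.inr i)) j fun _ => by simp [r1]
  have h₂₁ : Z.toBlocks₂₁ = 0 := by
    ext i j
    exact Complex.ext (hre i j) (him (Sum.inr i) j)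
  refine ⟨Z.toBlocks₁₁.map Complex.re, Z.toBlocks₂₂, ?_⟩
  rw [Dmat, ← toBlocks₁₂_eq_zero_of_mem_unitaryGroup hZ h₂₁, ← h₂₁]
  conv_lhs => rw [← fromBlocks_toBlocks Z]
  rw [fromBlocks_inj]
  refine ⟨?_, rfl, rfl, rfl⟩
  ext i j
  exact Complex.ext rfl (him (Sum.inl i) j)

/-- `Sp(k,ℓ) ∩ u(U(ℓ)) = {u(D(A,Z)) : A ∈ O(k), Z ∈ U(ℓ-k)}`;
consequently `(A,Z) ↦ u(D(A,Z))` is a group isomorphism from `O(k) × U(ℓ-k)`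
onto `Sp(k,ℓ) ∩ u(U(ℓ))`. -/
theorem stmt9 (k m : ℕ) (hk : 1 ≤ k) :
    ({M | M ∈ SpKL k m ∧ ∃ Z ∈ Matrix.unitaryGroup (HalfIdx k m) ℂ, M = uMap k m Z}
      = {M | ∃ A Z, A ∈ Matrix.orthogonalGroup (Fin k) ℝ ∧
          Z ∈ Matrix.unitaryGroup (Fin m) ℂ ∧ M = uMap k m (Dmat k m A Z)}) ∧
    (∀ (A A' : Matrix (Fin k) (Fin k) ℝ) (Z Z' : Matrix (Fin m) (Fin m) ℂ),
      A ∈ Matrix.orthogonalGroup (Fin k) ℝ → A' ∈ Matrix.orthogonalGroup (Fin k) ℝ →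
      Z ∈ Matrix.unitaryGroup (Fin m) ℂ → Z' ∈ Matrix.unitaryGroup (Fin m) ℂ →
      uMap k m (Dmat k m A Z) = uMap k m (Dmat k m A' Z') → A = A' ∧ Z = Z') ∧
    (∀ (A A' : Matrix (Fin k) (Fin k) ℝ) (Z Z' : Matrix (Fin m) (Fin m) ℂ),
      A ∈ Matrix.orthogonalGroup (Fin k) ℝ → A' ∈ Matrix.orthogonalGroup (Fin k) ℝ →
      Z ∈ Matrix.unitaryGroup (Fin m) ℂ → Z' ∈ Matrix.unitaryGroup (Fin m) ℂ →
      uMap k m (Dmat k m (A * A') (Z * Z'))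
        = uMap k m (Dmat k m A Z) * uMap k m (Dmat k m A' Z')) := by
  refine ⟨Set.ext fun M => ⟨?_, ?_⟩, fun A A' Z Z' _ _ _ _ h => Dmat_inj (uMap_injective k m h),
    fun A A' Z Z' _ _ _ _ => by rw [Dmat_mul, uMap_mul]⟩
  · rintro ⟨hM, Z, hZ, rfl⟩
    obtain ⟨A, W, rfl⟩ := exists_eq_Dmat_of_uMap_mem_SpKL hZ hM
    obtain ⟨hA, hW⟩ := Dmat_mem_unitaryGroup_iff.1 hZ
    exact ⟨A, W, hA, hW, rfl⟩
  · rintro ⟨A, Z, hA, hZ, rfl⟩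
    have hD := Dmat_mem_unitaryGroup_iff.2 ⟨hA, hZ⟩
    exact ⟨uMap_Dmat_mem_SpKL hD, Dmat k m A Z, hD, rfl⟩
end

section
/- T ∩ u(U(ℓ)) = {I_{2ℓ}}: if M ∈ ker(ϖ) lies in the image of u (equivalently, M is both symplectic and orthogonal of the form [[X,−Y],[Y,X]] with X+iY unitary), then M = I_{2ℓ}. -/
open Matrix

/-- A block upper-triangular unitary matrix with identity diagonal blocks is the identity. -/
theorem eq_one_of_mem_unitaryGroup_of_upper_unipotent {p q : Type*} [Fintype p] [Fintype q]
    [DecidableEq p] [DecidableEq q] {Z : Matrix (p ⊕ q) (p ⊕ q) ℂ}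
    (hZ : Z ∈ Matrix.unitaryGroup (p ⊕ q) ℂ) (h₁₁ : Z.toBlocks₁₁ = 1)
    (h₂₁ : Z.toBlocks₂₁ = 0) (h₂₂ : Z.toBlocks₂₂ = 1) : Z = 1 := by
  have h := Matrix.mem_unitaryGroup_iff'.mp hZ
  rw [← Matrix.fromBlocks_toBlocks Z, h₁₁, h₂₁, h₂₂, Matrix.star_eq_conjTranspose,
    Matrix.fromBlocks_conjTranspose, Matrix.fromBlocks_multiply, ← Matrix.fromBlocks_one,
    Matrix.fromBlocks_inj] at h
  have h₁₂ : Z.toBlocks₁₂ = 0 := by simpa using h.2.1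
  rw [← Matrix.fromBlocks_toBlocks Z, h₁₁, h₁₂, h₂₁, h₂₂, Matrix.fromBlocks_one]

/-- `T ∩ u(U(ℓ)) = {I}`: if `M ∈ ker(ϖ)` lies in the image of
`u`, then `M = I`. -/
theorem stmt11 (k m : ℕ) (hk : 1 ≤ k)
    (M : Matrix (FullIdx k m) (FullIdx k m) ℝ) (hM : M ∈ kerVarpi k m)
    (hu : ∃ Z ∈ Matrix.unitaryGroup (HalfIdx k m) ℂ, M = uMap k m Z) :
    M = 1 := by
  obtain ⟨Z, hZ, rfl⟩ := hu
  obtain ⟨⟨-, hcol⟩, h₁, h₂⟩ := hM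
  have hZ1 : Z = 1 := by
    refine eq_one_of_mem_unitaryGroup_of_upper_unipotent hZ ?_ ?_ ?_
    · ext i j
      have hre : (Z (Sum.inl i) (Sum.inl j)).re = (1 : Matrix (Fin k) (Fin k) ℝ) i j :=
        congrFun₂ h₁ i j
      have him : (Z (Sum.inl i) (Sum.inl j)).im = 0 := hcol (r3 k m i) j (by simp [r1, r3])
      apply Complex.ext
      · simpa [Matrix.toBlocks₁₁, Matrix.one_apply, apply_ite Complex.re] using hre
      · simpa [Matrix.toBlocks₁₁, Matrix.one_apply, apply_ite Complex.im] using him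
    · ext i j
      exact Complex.ext (hcol (r2 k m i) j (by simp [r1, r2]))
        (hcol (r4 k m i) j (by simp [r1, r4]))
    · ext i j
      have hre : (Z (Sum.inr i) (Sum.inr j)).re =
          (1 : Matrix (Fin m ⊕ Fin m) (Fin m ⊕ Fin m) ℝ) (Sum.inl i) (Sum.inl j) :=
        congrFun₂ h₂ (Sum.inl i) (Sum.inl j)
      have him : (Z (Sum.inr i) (Sum.inr j)).im =
          (1 : Matrix (Fin m ⊕ Fin m) (Fin m ⊕ Fin m) ℝ) (Sum.inr i) (Sum.inl j) :=
        congrFun₂ h₂ (Sum.inr i) (Sum.inl j)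
      apply Complex.ext
      · simpa [Matrix.toBlocks₂₂, Matrix.one_apply, apply_ite Complex.re] using hre
      · simpa [Matrix.toBlocks₂₂, Matrix.one_apply, apply_ite Complex.im] using him
  have hre : (1 : Matrix (HalfIdx k m) (HalfIdx k m) ℂ).map Complex.re = 1 :=
    Matrix.map_one _ Complex.zero_re Complex.one_re
  have him : (1 : Matrix (HalfIdx k m) (HalfIdx k m) ℂ).map Complex.im = 0 := by
    ext i j
    simp [Matrix.one_apply, apply_ite Complex.im]
  rw [hZ1, uMap, hre, him, neg_zero, Matrix.fromBlocks_one]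
end

section
/- ker(γ) ∩ u(U(ℓ)) = {u(D(A, I_{ℓ−k})) : A ∈ SO(k)}; that is, the elements of ker(γ) lying in the image of u are exactly the block-diagonal matrices with diagonal blocks (A, I_{ℓ−k}, A, I_{ℓ−k}) for A ∈ SO(k). -/
open Matrix

theorem uMap_Dmat_one (k m : ℕ) (A : Matrix (Fin k) (Fin k) ℝ) :
    uMap k m (Dmat k m A 1) =
      fromBlocks (fromBlocks A 0 0 1) 0 0 (fromBlocks A 0 0 1) := by
  ext (i | i) (j | j) <;> rcases i with i | i <;> rcases j with j | j <;>
    simp [uMap, Dmat, Matrix.one_apply, apply_ite Complex.re, apply_ite Complex.im]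

theorem Dmat_one_mem_unitaryGroup_iff (k m : ℕ) (A : Matrix (Fin k) (Fin k) ℝ) :
    Dmat k m A 1 ∈ unitaryGroup (HalfIdx k m) ℂ ↔ A ∈ orthogonalGroup (Fin k) ℝ := by
  have key : Dmat k m A 1 * star (Dmat k m A 1) =
      fromBlocks ((A * Aᵀ).map fun x => (x : ℂ)) 0 0 1 := by
    have hA : (A.map fun x => (x : ℂ))ᴴ = Aᵀ.map fun x => (x : ℂ) := by
      ext i j; simp
    have hmul : (A * Aᵀ).map (fun x => (x : ℂ)) =
        (A.map fun x => (x : ℂ)) * (Aᵀ.map fun x => (x : ℂ)) :=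
      Matrix.map_mul (f := Complex.ofRealHom)
    simp [Dmat, star_eq_conjTranspose, fromBlocks_conjTranspose, fromBlocks_multiply, hA, hmul]
  rw [mem_unitaryGroup_iff, mem_orthogonalGroup_iff, key, ← fromBlocks_one, fromBlocks_inj]
  simp only [and_true]
  rw [← Matrix.map_one (fun x : ℝ => (x : ℂ)) Complex.ofReal_zero Complex.ofReal_one]
  exact (Matrix.map_injective Complex.ofReal_injective).eq_iff

theorem uMap_Dmat_one_mem_kerGamma (k m : ℕ) {A : Matrix (Fin k) (Fin k) ℝ}
    (hA : A ∈ orthogonalGroup (Fin k) ℝ) (hdet : 0 < A.det) :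
    uMap k m (Dmat k m A 1) ∈ kerGamma k m := by
  have hAt : Aᵀ * A = 1 := (mem_orthogonalGroup_iff' _ _).mp hA
  rw [uMap_Dmat_one]
  refine ⟨⟨⟨?_, ?_⟩, hdet⟩, ?_⟩
  · simp [SpBig, Jmat, fromBlocks_transpose, fromBlocks_multiply, hAt]
  · rintro ((i | i) | i | i) j h
    · exact absurd rfl (h i)
    all_goals rfl
  · ext (i | i) (j | j) <;> simp [blk2, embSmall, Matrix.one_apply]

/-- A unitary matrix whose image under `u` is in the kernel of `γ` has the form `D(A, I)`. -/
theorem exists_eq_Dmat_one (k m : ℕ) {Z : Matrix (HalfIdx k m) (HalfIdx k m) ℂ}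
    (hZ : Z ∈ unitaryGroup (HalfIdx k m) ℂ) (h : uMap k m Z ∈ kerGamma k m) :
    ∃ A : Matrix (Fin k) (Fin k) ℝ, 0 < A.det ∧ Z = Dmat k m A 1 := by
  obtain ⟨⟨⟨-, h0⟩, hdet⟩, h2⟩ := h
  have h11 : Z.toBlocks₁₁ = (blk1 k m (uMap k m Z)).map fun x => (x : ℂ) := by
    ext i j
    have hi : (Z (Sum.inl i) (Sum.inl j)).im = 0 := h0 (r3 k m i) j (by simp [r1, r3])
    exact Complex.ext rfl hi
  have h21 : Z.toBlocks₂₁ = 0 := by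
    ext i j
    exact Complex.ext (h0 (r2 k m i) j (by simp [r1, r2])) (h0 (r4 k m i) j (by simp [r1, r4]))
  have h22 : Z.toBlocks₂₂ = 1 := by
    ext i j
    have hr : (Z (Sum.inr i) (Sum.inr j)).re = _ := congr_fun₂ h2 (Sum.inl i) (Sum.inl j)
    have hi : (Z (Sum.inr i) (Sum.inr j)).im = _ := congr_fun₂ h2 (Sum.inr i) (Sum.inl j)
    apply Complex.ext
    · simpa [toBlocks₂₂, Matrix.one_apply, apply_ite Complex.re] using hr
    · simpa [toBlocks₂₂, Matrix.one_apply, apply_ite Complex.im] using hi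
  have h12 : Z.toBlocks₁₂ = 0 := by
    have hu := (mem_unitaryGroup_iff (A := Z)).mp hZ
    rw [← fromBlocks_toBlocks Z, h21, h22, star_eq_conjTranspose, fromBlocks_conjTranspose,
      fromBlocks_multiply, ← fromBlocks_one, fromBlocks_inj] at hu
    simpa using hu.2.1
  refine ⟨blk1 k m (uMap k m Z), hdet, ?_⟩
  rw [Dmat, ← h11, ← fromBlocks_toBlocks Z, h12, h21, h22, toBlocks_fromBlocks₁₁]

/-- `ker(γ) ∩ u(U(ℓ)) = {u(D(A, I)) : A ∈ SO(k)}`. -/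
theorem stmt12 (k m : ℕ) (hk : 1 ≤ k) :
    {M | M ∈ kerGamma k m ∧ ∃ Z ∈ Matrix.unitaryGroup (HalfIdx k m) ℂ, M = uMap k m Z}
      = {M | ∃ A : Matrix (Fin k) (Fin k) ℝ, A ∈ Matrix.orthogonalGroup (Fin k) ℝ ∧
          A.det = 1 ∧ M = uMap k m (Dmat k m A 1)} := by
  ext M
  constructor
  · rintro ⟨hM, Z, hZ, rfl⟩
    obtain ⟨A, hdet, rfl⟩ := exists_eq_Dmat_one k m hZ hM
    have hA := (Dmat_one_mem_unitaryGroup_iff k m A).mp hZ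
    have hsq : A.det * A.det = 1 := by
      simpa using congrArg Matrix.det ((mem_orthogonalGroup_iff _ _).mp hA)
    exact ⟨A, hA, by nlinarith, rfl⟩
  · rintro ⟨A, hA, hdet, rfl⟩
    exact ⟨uMap_Dmat_one_mem_kerGamma k m hA (hdet ▸ one_pos), _,
      (Dmat_one_mem_unitaryGroup_iff k m A).mpr hA, rfl⟩
end
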